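/- arXiv:2407.17466 — 12 statements merged into one kernel-verified Lean document; each statement's English description precedes it below -/
import Mathlib

section
/- Suppose Π is a nonempty compact topological space and f : Π → ℝ^m is continuous. Then for every policy π ∈ Π that is not Pareto optimal there exists a Pareto optimal policy π* ∈ Π_P that dominates π; in particular, Π_P is nonempty. -/
/-- `π'` dominates `π`: it is at least as good on every objective and strictly
better on at least one objective. -/
def Dominates {Pol : Type*} {m : ℕ} (f : Pol → Fin m → ℝ) (π' π : Pol) : Prop :=
  (∀ i, f π i ≤ f π' i) ∧ ∃ j, f π j < f π' j

/-- A policy is Pareto optimal iff no policy dominates it. -/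
def ParetoOptimal {Pol : Type*} {m : ℕ} (f : Pol → Fin m → ℝ) (π : Pol) : Prop :=
  ¬ ∃ π' : Pol, Dominates f π' π

/-- Every policy is weakly dominated by a Pareto optimal one: maximize the sum of
objectives over the compact set of policies at least as good. -/
theorem exists_pareto_ge
    {Pol : Type*} [TopologicalSpace Pol] [CompactSpace Pol]
    {m : ℕ} (f : Pol → Fin m → ℝ) (hf : Continuous f) (π : Pol) :
    ∃ πs : Pol, ParetoOptimal f πs ∧ ∀ i, f π i ≤ f πs i := by
  have hfi : ∀ i, Continuous fun x => f x i := fun i => (continuous_apply i).comp hf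
  have hcl : IsClosed {x : Pol | ∀ i, f π i ≤ f x i} := by
    rw [Set.setOf_forall]
    exact isClosed_iInter fun i => isClosed_le continuous_const (hfi i)
  obtain ⟨s, hs, hmax⟩ := hcl.isCompact.exists_isMaxOn ⟨π, fun i => le_rfl⟩
    (f := fun x => ∑ i, f x i) (continuous_finsetSum _ fun i _ => hfi i).continuousOn
  refine ⟨s, ?_, hs⟩
  rintro ⟨t, ht, j, hj⟩
  have h1 : ∑ i, f t i ≤ ∑ i, f s i := hmax (fun i => (hs i).trans (ht i))
  have h2 : ∑ i, f s i < ∑ i, f t i :=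
    Finset.sum_lt_sum (fun i _ => ht i) ⟨j, Finset.mem_univ j, hj⟩
  exact absurd h1 (not_le.mpr h2)

/-- If the policy class is a nonempty compact topological space and the objective
vector map is continuous, then every non-Pareto-optimal policy is dominated by
some Pareto optimal policy; in particular the Pareto set is nonempty. -/
theorem exists_pareto_dominating
    {Pol : Type*} [TopologicalSpace Pol] [CompactSpace Pol] [Nonempty Pol]
    {m : ℕ} (hm : 1 ≤ m) (f : Pol → Fin m → ℝ) (hf : Continuous f) :
    (∀ π : Pol, ¬ ParetoOptimal f π →
        ∃ πs : Pol, ParetoOptimal f πs ∧ Dominates f πs π) ∧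
      ∃ πs : Pol, ParetoOptimal f πs := by
  refine ⟨fun π hπ => ?_, ?_⟩
  · obtain ⟨t, ht, j, hj⟩ := not_not.mp hπ
    obtain ⟨s, hs, hst⟩ := exists_pareto_ge f hf t
    exact ⟨s, hs, fun i => (ht i).trans (hst i), j, hj.trans_le (hst j)⟩
  · obtain ⟨π⟩ := ‹Nonempty Pol›
    obtain ⟨s, hs, _⟩ := exists_pareto_ge f hf π
    exact ⟨s, hs⟩
end

section
/- Suppose Π is a nonempty compact topological space and f : Π → ℝ^m is continuous. Then a policy π ∈ Π is Pareto optimal if and only if π is not dominated by any Pareto optimal policy π* ∈ Π_P. -/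
/-- If the policy class is a nonempty compact topological space and the objective
vector map is continuous, then a policy is Pareto optimal if and only if it is
not dominated by any Pareto optimal policy. -/
theorem pareto_iff_not_dominated_by_pareto
    {Pol : Type*} [TopologicalSpace Pol] [CompactSpace Pol] [Nonempty Pol]
    {m : ℕ} (hm : 1 ≤ m) (f : Pol → Fin m → ℝ) (hf : Continuous f) (π : Pol) :
    ParetoOptimal f π ↔ ¬ ∃ πs : Pol, ParetoOptimal f πs ∧ Dominates f πs π := by
  constructor
  · rintro h ⟨p, _, hp⟩
    exact h ⟨p, hp⟩
  · rintro h ⟨q, hq⟩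
    apply h
    -- maximize the sum of objectives over the compact set of policies at least as good as `q`
    have hcl : IsClosed {x : Pol | ∀ i, f q i ≤ f x i} := by
      simp only [Set.setOf_forall]
      exact isClosed_iInter fun i =>
        isClosed_le continuous_const ((continuous_apply i).comp hf)
    have hsum : Continuous fun x => ∑ i, f x i :=
      continuous_finsetSum _ fun i _ => (continuous_apply i).comp hf
    obtain ⟨p, hp, hmax⟩ := hcl.isCompact.exists_isMaxOn
      ⟨q, fun i => le_refl (f q i)⟩ hsum.continuousOn
    have hp' : ∀ i, f q i ≤ f p i := hp
    refine ⟨p, ?_, fun i => (hq.1 i).trans (hp' i), ?_⟩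
    · rintro ⟨r, hr, j, hj⟩
      have h1 : ∑ i, f r i ≤ ∑ i, f p i := hmax (fun i => (hp' i).trans (hr i))
      have h2 : ∑ i, f p i < ∑ i, f r i :=
        Finset.sum_lt_sum (fun i _ => hr i) ⟨j, Finset.mem_univ j, hj⟩
      exact absurd h1 (not_le.mpr h2)
    · obtain ⟨j, hj⟩ := hq.2
      exact ⟨j, hj.trans_le (hp' j)⟩
end

section
/- For a finite-horizon tabular multi-objective MDP, the set of achievable value vectors of stochastic policies, 𝕍(Π) := { (V_{1,1}^π(s₁), …, V_{m,1}^π(s₁)) : π a stochastic policy } ⊆ ℝ^m, is a convex polytope, i.e., there exists a finite set F ⊆ ℝ^m such that 𝕍(Π) equals the convex hull of F. -/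
/-- The value function of a finite-horizon tabular MDP with transition kernels `P`,
(scalar) reward `r` and stochastic policy `π`, computed by backward recursion.
`mdpVal P r π k s` is the value at state `s` with `k` steps remaining, i.e. the
value `V_{h}` at step `h = H - k + 1` (so `mdpVal P r π H s₁` is `V_1(s₁)`). -/
noncomputable def mdpVal {S A : Type*} [Fintype S] [Fintype A] {H : ℕ}
    (P : Fin H → S → A → S → ℝ) (r : Fin H → S → A → ℝ)
    (π : Fin H → S → A → ℝ) : ℕ → S → ℝ
  | 0, _ => 0
  | k + 1, s =>
    if hh : H - (k + 1) < H then
      ∑ a, π ⟨H - (k + 1), hh⟩ s a *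
        (r ⟨H - (k + 1), hh⟩ s a +
          ∑ s', P ⟨H - (k + 1), hh⟩ s a s' * mdpVal P r π k s')
    else 0

/-- A stochastic (Markov, time-dependent) policy: a probability distribution over
actions at every step and state. -/
def IsStochasticPolicy {S A : Type*} [Fintype A] {H : ℕ}
    (π : Fin H → S → A → ℝ) : Prop :=
  (∀ h s a, 0 ≤ π h s a) ∧ ∀ h s, ∑ a, π h s a = 1

theorem mdpVal_congr {S A : Type*} [Fintype S] [Fintype A] {H : ℕ}
    (P : Fin H → S → A → S → ℝ) (r : Fin H → S → A → ℝ)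
    (π π' : Fin H → S → A → ℝ) (k : ℕ) (hk : k ≤ H)
    (h : ∀ j : Fin H, H - k ≤ j.val → π j = π' j) (s : S) :
    mdpVal P r π k s = mdpVal P r π' k s := by
  induction k generalizing s with
  | zero => simp [mdpVal]
  | succ k ih =>
    have ih' := ih (by omega) (fun j hj => h j (by omega))
    have hh : H - (k + 1) < H := by omega
    simp only [mdpVal, dif_pos hh, ih', h ⟨H - (k + 1), hh⟩ le_rfl]

theorem mdpVal_update {S A : Type*} [Fintype S] [Fintype A] {H : ℕ}
    (P : Fin H → S → A → S → ℝ) (r : Fin H → S → A → ℝ)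
    (π : Fin H → S → A → ℝ) (k : ℕ) (hh : H - (k + 1) < H) (hk : k + 1 ≤ H)
    (p : S → A → ℝ) (s : S) :
    mdpVal P r (Function.update π ⟨H - (k + 1), hh⟩ p) (k + 1) s =
      ∑ a, p s a * (r ⟨H - (k + 1), hh⟩ s a +
          ∑ s', P ⟨H - (k + 1), hh⟩ s a s' * mdpVal P r π k s') := by
  have key : ∀ s', mdpVal P r (Function.update π ⟨H - (k + 1), hh⟩ p) k s' =
      mdpVal P r π k s' := by
    intro s'
    apply mdpVal_congr _ _ _ _ _ (by omega)
    intro j hj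
    apply Function.update_of_ne
    intro hj'
    rw [hj'] at hj
    simp only at hj
    omega
  simp only [mdpVal, dif_pos hh, Function.update_self, key]

theorem isStochasticPolicy_update {S A : Type*} [Fintype A] {H : ℕ}
    {π : Fin H → S → A → ℝ} (hπ : IsStochasticPolicy π) (j : Fin H) (p : S → A → ℝ)
    (h0 : ∀ s a, 0 ≤ p s a) (h1 : ∀ s, ∑ a, p s a = 1) :
    IsStochasticPolicy (Function.update π j p) := by
  constructor
  · intro h s a
    by_cases hj : h = j
    · subst hj; simpa using h0 s a
    · rw [Function.update_of_ne hj]; exact hπ.1 h s a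
  · intro h s
    by_cases hj : h = j
    · subst hj; simpa using h1 s
    · rw [Function.update_of_ne hj]; exact hπ.2 h s

theorem sum_flow {S A : Type*} [Fintype S] [Fintype A]
    (q : S → A → ℝ) (R : S → A → ℝ) (T : S → A → S → ℝ) (V : S → ℝ) :
    ∑ s, ∑ a, q s a * (R s a + ∑ s', T s a s' * V s') =
      ∑ s, ∑ a, q s a * R s a + ∑ s', (∑ s, ∑ a, q s a * T s a s') * V s' := by
  have : ∑ s', (∑ s, ∑ a, q s a * T s a s') * V s' =
      ∑ s, ∑ a, q s a * ∑ s', T s a s' * V s' := by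
    simp only [Finset.sum_mul, Finset.mul_sum]
    rw [Finset.sum_comm]
    refine Finset.sum_congr rfl fun s _ => ?_
    rw [Finset.sum_comm]
    simp only [mul_assoc]
  rw [this]
  simp only [mul_add, Finset.sum_add_distrib]

theorem mdpVal_mix {S A : Type*} [Fintype S] [Fintype A] {H : ℕ}
    (P : Fin H → S → A → S → ℝ) (hP0 : ∀ h s a s', 0 ≤ P h s a s')
    (π π' : Fin H → S → A → ℝ) (hπ : IsStochasticPolicy π) (hπ' : IsStochasticPolicy π')
    (k : ℕ) (hk : k ≤ H) (μ μ' : S → ℝ) (hμ : ∀ s, 0 ≤ μ s) (hμ' : ∀ s, 0 ≤ μ' s) :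
    ∃ ρ : Fin H → S → A → ℝ, IsStochasticPolicy ρ ∧ ∀ r : Fin H → S → A → ℝ,
      ∑ s, (μ s + μ' s) * mdpVal P r ρ k s =
        ∑ s, μ s * mdpVal P r π k s + ∑ s, μ' s * mdpVal P r π' k s := by
  induction k generalizing μ μ' with
  | zero => exact ⟨π, hπ, fun r => by simp [mdpVal]⟩
  | succ k ih =>
    have hh : H - (k + 1) < H := by omega
    set j : Fin H := ⟨H - (k + 1), hh⟩ with hj
    obtain ⟨ρ, hρ, hval⟩ := ih (by omega)
      (fun s' => ∑ s, ∑ a, (μ s * π j s a) * P j s a s')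
      (fun s' => ∑ s, ∑ a, (μ' s * π' j s a) * P j s a s')
      (fun s' => Finset.sum_nonneg fun s _ => Finset.sum_nonneg fun a _ =>
        mul_nonneg (mul_nonneg (hμ s) (hπ.1 _ _ _)) (hP0 _ _ _ _))
      (fun s' => Finset.sum_nonneg fun s _ => Finset.sum_nonneg fun a _ =>
        mul_nonneg (mul_nonneg (hμ' s) (hπ'.1 _ _ _)) (hP0 _ _ _ _))
    have hp : ∀ s, ∃ p : A → ℝ, (∀ a, 0 ≤ p a) ∧ ∑ a, p a = 1 ∧
        ∀ a, (μ s + μ' s) * p a = μ s * π j s a + μ' s * π' j s a := by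
      intro s
      by_cases h0 : μ s + μ' s = 0
      · have h1 : μ s = 0 := by linarith [hμ s, hμ' s]
        have h2 : μ' s = 0 := by linarith [hμ s, hμ' s]
        exact ⟨π j s, hπ.1 j s, hπ.2 j s, fun a => by simp [h1, h2]⟩
      · refine ⟨fun a => (μ s * π j s a + μ' s * π' j s a) / (μ s + μ' s), fun a => ?_, ?_,
          fun a => ?_⟩
        · exact div_nonneg (add_nonneg (mul_nonneg (hμ s) (hπ.1 _ _ _))
            (mul_nonneg (hμ' s) (hπ'.1 _ _ _))) (add_nonneg (hμ s) (hμ' s))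
        · rw [← Finset.sum_div, Finset.sum_add_distrib, ← Finset.mul_sum, ← Finset.mul_sum,
            hπ.2, hπ'.2, mul_one, mul_one, div_self h0]
        · field_simp
    choose p hp0 hp1 hpm using hp
    refine ⟨Function.update ρ j p, isStochasticPolicy_update hρ j p hp0 hp1, fun r => ?_⟩
    have e : ∀ (ν : S → ℝ) (τ : Fin H → S → A → ℝ),
        ∑ s, ν s * mdpVal P r τ (k + 1) s =
          ∑ s, ∑ a, (ν s * τ j s a) * r j s a +
          ∑ s', (∑ s, ∑ a, (ν s * τ j s a) * P j s a s') * mdpVal P r τ k s' := by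
      intro ν τ
      rw [← sum_flow]
      refine Finset.sum_congr rfl fun s _ => ?_
      simp only [mdpVal, dif_pos hh, Finset.mul_sum, mul_assoc, hj]
    rw [e μ π, e μ' π']
    have e2 : ∑ s, (μ s + μ' s) * mdpVal P r (Function.update ρ j p) (k + 1) s =
        ∑ s, ∑ a, (μ s * π j s a + μ' s * π' j s a) * r j s a +
        ∑ s', (∑ s, ∑ a, (μ s * π j s a + μ' s * π' j s a) * P j s a s') *
          mdpVal P r ρ k s' := by
      rw [← sum_flow]
      refine Finset.sum_congr rfl fun s _ => ?_
      rw [hj, mdpVal_update P r ρ k hh hk, Finset.mul_sum]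
      refine Finset.sum_congr rfl fun a _ => ?_
      rw [← mul_assoc, hpm]
    have h3 := hval r
    rw [e2]
    simp only [add_mul, Finset.sum_add_distrib] at h3 ⊢
    linarith

theorem mdpVal_linear {S A ι : Type*} [Fintype S] [Fintype A] [Fintype ι] {H : ℕ}
    (P : Fin H → S → A → S → ℝ) (r : ι → Fin H → S → A → ℝ) (c : ι → ℝ)
    (π : Fin H → S → A → ℝ) (k : ℕ) (s : S) :
    mdpVal P (fun h s a => ∑ i, c i * r i h s a) π k s =
      ∑ i, c i * mdpVal P (r i) π k s := by
  induction k generalizing s with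
  | zero => simp [mdpVal]
  | succ k ih =>
    by_cases hh : H - (k + 1) < H
    · simp only [mdpVal, dif_pos hh, ih]
      simp only [Finset.mul_sum, mul_add, Finset.sum_add_distrib]
      congr 1
      · rw [Finset.sum_comm]
        refine Finset.sum_congr rfl fun i _ => Finset.sum_congr rfl fun a _ => by ring
      · conv_rhs => rw [Finset.sum_comm]
        refine Finset.sum_congr rfl fun a _ => ?_
        rw [Finset.sum_comm]
        refine Finset.sum_congr rfl fun i _ => Finset.sum_congr rfl fun a _ => by ring
    · simp only [mdpVal, dif_neg hh]; simp

/-- The stochastic policy associated with a deterministic one. -/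
noncomputable def detPol {S A : Type*} {H : ℕ} (g : Fin H → S → A) : Fin H → S → A → ℝ :=
  open Classical in fun h s a => if a = g h s then 1 else 0

theorem detPol_stochastic {S A : Type*} [Fintype A] {H : ℕ} (g : Fin H → S → A) :
    IsStochasticPolicy (detPol g) := by
  classical
  constructor
  · intro h s a
    unfold detPol
    split_ifs <;> norm_num
  · intro h s
    simp [detPol]

theorem exists_det_ge {S A : Type*} [Fintype S] [Fintype A] [Nonempty A] {H : ℕ}
    (P : Fin H → S → A → S → ℝ) (hP0 : ∀ h s a s', 0 ≤ P h s a s')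
    (r : Fin H → S → A → ℝ) (π : Fin H → S → A → ℝ) (hπ : IsStochasticPolicy π)
    (k : ℕ) (hk : k ≤ H) :
    ∃ g : Fin H → S → A, ∀ s, mdpVal P r π k s ≤ mdpVal P r (detPol g) k s := by
  classical
  induction k with
  | zero => exact ⟨fun _ _ => Classical.arbitrary A, fun s => by simp [mdpVal]⟩
  | succ k ih =>
    obtain ⟨g, hg⟩ := ih (by omega)
    have hh : H - (k + 1) < H := by omega
    set j : Fin H := ⟨H - (k + 1), hh⟩ with hj
    have hb : ∀ s, ∃ b : A, ∀ a,
        r j s a + ∑ s', P j s a s' * mdpVal P r (detPol g) k s' ≤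
        r j s b + ∑ s', P j s b s' * mdpVal P r (detPol g) k s' := fun s =>
      Finite.exists_max _
    choose b hb using hb
    refine ⟨Function.update g j b, fun s => ?_⟩
    have e : detPol (Function.update g j b) =
        Function.update (detPol g) j (fun s a => if a = b s then 1 else 0) := by
      funext h s a
      by_cases hhj : h = j
      · subst hhj; simp [detPol]
      · simp [detPol, Function.update_of_ne hhj]
    rw [e, hj, mdpVal_update P r _ k hh hk]
    simp only [ite_mul, one_mul, zero_mul, Finset.sum_ite_eq', Finset.mem_univ, if_true]
    simp only [mdpVal, dif_pos hh]
    calc _ ≤ ∑ a, π j s a * (r j s (b s) +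
          ∑ s', P j s (b s) s' * mdpVal P r (detPol g) k s') := by
            refine Finset.sum_le_sum fun a _ => mul_le_mul_of_nonneg_left ?_ (hπ.1 _ _ _)
            refine le_trans ?_ (hb s a)
            refine add_le_add le_rfl (Finset.sum_le_sum fun s' _ => ?_)
            exact mul_le_mul_of_nonneg_left (hg s') (hP0 _ _ _ _)
      _ = _ := by rw [← Finset.sum_mul, hπ.2, one_mul]

/-- For a finite-horizon tabular multi-objective MDP, the set of achievable value
vectors of stochastic policies is a convex polytope (the convex hull of finitely
many points of `ℝ^m`). -/
theorem value_set_convex_polytope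
    {S A : Type*} [Fintype S] [Fintype A] [Nonempty S] [Nonempty A]
    {m H : ℕ} (hm : 1 ≤ m) (hH : 1 ≤ H) (s₁ : S)
    (P : Fin H → S → A → S → ℝ)
    (hP0 : ∀ h s a s', 0 ≤ P h s a s') (hP1 : ∀ h s a, ∑ s', P h s a s' = 1)
    (r : Fin m → Fin H → S → A → ℝ)
    (hr : ∀ i h s a, r i h s a ∈ Set.Icc (0 : ℝ) 1) :
    ∃ F : Finset (Fin m → ℝ),
      {v : Fin m → ℝ | ∃ π : Fin H → S → A → ℝ, IsStochasticPolicy π ∧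
          ∀ i, v i = mdpVal P (r i) π H s₁}
        = convexHull ℝ (F : Set (Fin m → ℝ)) := by
  classical
  have hfin : (Set.range fun (g : Fin H → S → A) (i : Fin m) =>
      mdpVal P (r i) (detPol g) H s₁).Finite := Set.finite_range _
  refine ⟨hfin.toFinset, ?_⟩
  rw [Set.Finite.coe_toFinset]
  apply Set.Subset.antisymm
  · rintro v ⟨π, hπ, hv⟩
    by_contra hnot
    obtain ⟨f, u, hfu, hux⟩ := geometric_hahn_banach_closed_point (convex_convexHull ℝ _)
      (hfin.isClosed_convexHull ℝ) hnot
    have hf : ∀ x : Fin m → ℝ, f x = ∑ i, f (Pi.single i 1) * x i := by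
      intro x
      conv_lhs => rw [pi_eq_sum_univ' x]
      rw [map_sum]
      refine Finset.sum_congr rfl fun i _ => ?_
      rw [map_smul, smul_eq_mul, mul_comm]
    obtain ⟨g, hg⟩ := exists_det_ge P hP0
      (fun h s a => ∑ i, f (Pi.single i 1) * r i h s a) π hπ H le_rfl
    have h1 := hg s₁
    rw [mdpVal_linear, mdpVal_linear] at h1
    have h2 := hfu _ (subset_convexHull ℝ _ ⟨g, rfl⟩)
    rw [hf] at h2 hux
    simp only [hv] at hux
    linarith
  · apply convexHull_min
    · rintro _ ⟨g, rfl⟩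
      exact ⟨detPol g, detPol_stochastic g, fun i => rfl⟩
    · rintro v ⟨π, hπ, hv⟩ w ⟨π', hπ', hw⟩ a b ha hb hab
      obtain ⟨ρ, hρ, hval⟩ := mdpVal_mix P hP0 π π' hπ hπ' H le_rfl
        (fun s => if s = s₁ then a else 0) (fun s => if s = s₁ then b else 0)
        (fun s => by split_ifs <;> simp [ha]) (fun s => by split_ifs <;> simp [hb])
      refine ⟨ρ, hρ, fun i => ?_⟩
      have h := hval (r i)
      simp only [add_mul, Finset.sum_add_distrib, ite_mul, zero_mul, Finset.sum_ite_eq',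
        Finset.mem_univ, if_true] at h
      rw [← add_mul, hab, one_mul] at h
      simp [h, hv, hw]
end

section
/- Suppose the image f(Π) ⊆ ℝ^m is a convex polytope (the convex hull of a finite set of points). Then { π ∈ Π : there exists λ ∈ Δ_m such that π maximizes π' ↦ Σ_{i=1}^m λ_i f_i(π') over Π } = Π_W, and { π ∈ Π : there exists λ ∈ Δ_m^o such that π maximizes π' ↦ Σ_{i=1}^m λ_i f_i(π') over Π } = Π_P. -/
/-- A policy is weakly Pareto optimal iff no policy is strictly better on all
objectives simultaneously. -/
def WeaklyParetoOptimal {Pol : Type*} {m : ℕ} (f : Pol → Fin m → ℝ) (π : Pol) : Prop :=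
  ¬ ∃ π' : Pol, ∀ i, f π i < f π' i

/-- Farkas' lemma (Bartl's algebraic proof). -/
theorem farkas_aux {V ι : Type*} [AddCommGroup V] [Module ℝ V] [DecidableEq ι]
    (s : Finset ι) : ∀ (a : ι → V →ₗ[ℝ] ℝ) (γ : V →ₗ[ℝ] ℝ),
      (∀ x, (∀ i ∈ s, a i x ≤ 0) → γ x ≤ 0) →
      ∃ c : ι → ℝ, (∀ i, 0 ≤ c i) ∧ ∀ x, γ x = ∑ i ∈ s, c i * a i x := by
  induction s using Finset.induction_on with
  | empty =>
    intro a γ h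
    refine ⟨0, fun i => le_rfl, fun x => ?_⟩
    have h1 := h x (by simp)
    have h2 := h (-x) (by simp)
    simp only [map_neg] at h2
    simp only [Finset.sum_empty]
    linarith
  | insert n s hn ih =>
    intro a γ h
    by_cases hc : ∀ x, (∀ i ∈ s, a i x ≤ 0) → γ x ≤ 0
    · obtain ⟨c, hc0, hc1⟩ := ih a γ hc
      refine ⟨fun i => if i = n then 0 else c i, fun i => ?_, fun x => ?_⟩
      · dsimp only
        split_ifs
        · exact le_rfl
        · exact hc0 i
      · rw [Finset.sum_insert hn, hc1 x]
        simp only [if_true, zero_mul, zero_add]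
        refine Finset.sum_congr rfl fun i hi => ?_
        have hin : i ≠ n := fun e => hn (e ▸ hi)
        rw [if_neg hin]
    · push Not at hc
      obtain ⟨z, hz, hγz⟩ := hc
      have hnz : 0 < a n z := by
        by_contra hle
        push Not at hle
        have := h z (by
          intro i hi
          rcases Finset.mem_insert.1 hi with rfl | hi
          · exact hle
          · exact hz i hi)
        linarith
      set t := (a n z)⁻¹ with ht
      have ht0 : 0 < t := inv_pos.2 hnz
      have htz : t * a n z = 1 := inv_mul_cancel₀ hnz.ne'
      obtain ⟨c, hc0, hc1⟩ := ih (fun i => a i - (t * a i z) • a n) (γ - (t * γ z) • a n) (by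
        intro x hx
        have := h (x - (t * a n x) • z) (by
          intro i hi
          rcases Finset.mem_insert.1 hi with rfl | hi
          · simp only [map_sub, map_smul, smul_eq_mul]
            have : t * a i x * a i z = a i x * (t * a i z) := by ring
            rw [this, htz]; simp
          · have := hx i hi
            simp only [LinearMap.sub_apply, LinearMap.smul_apply, smul_eq_mul] at this
            simp only [map_sub, map_smul, smul_eq_mul]
            linarith)
        simp only [map_sub, map_smul, smul_eq_mul] at this
        simp only [LinearMap.sub_apply, LinearMap.smul_apply, smul_eq_mul]
        linarith)
      have hsum : ∑ i ∈ s, c i * (t * a i z) ≤ 0 :=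
        Finset.sum_nonpos fun i hi => mul_nonpos_of_nonneg_of_nonpos (hc0 i)
          (mul_nonpos_of_nonneg_of_nonpos ht0.le (hz i hi))
      refine ⟨fun i => if i = n then t * γ z - ∑ i ∈ s, c i * (t * a i z) else c i,
        fun i => ?_, fun x => ?_⟩
      · dsimp only
        split_ifs
        · have := mul_pos ht0 hγz
          linarith
        · exact hc0 i
      · rw [Finset.sum_insert hn]
        have e : ∑ i ∈ s, (if i = n then t * γ z - ∑ i ∈ s, c i * (t * a i z) else c i) * a i x
            = ∑ i ∈ s, c i * a i x := by
          refine Finset.sum_congr rfl fun i hi => ?_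
          have hin : i ≠ n := fun e => hn (e ▸ hi)
          rw [if_neg hin]
        rw [e]
        simp only [if_true]
        have := hc1 x
        simp only [LinearMap.sub_apply, LinearMap.smul_apply, smul_eq_mul, mul_sub,
          Finset.sum_sub_distrib] at this
        have e2 : ∑ i ∈ s, c i * (t * a i z * a n x) = (∑ i ∈ s, c i * (t * a i z)) * a n x := by
          rw [Finset.sum_mul]
          exact Finset.sum_congr rfl fun i _ => by ring
        rw [e2] at this
        linarith

/-- Separation: if no point of the polytope lies above `x + t v`, `t > 0`, then some nonnegative
weight supports the polytope at `x` and is positive on `v`. -/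
theorem scalar_aux {m : ℕ} (F : Finset (Fin m → ℝ)) (x v : Fin m → ℝ)
    (hv : ∀ i, 0 ≤ v i) (hv' : ∃ j, 0 < v j)
    (hno : ¬ ∃ y ∈ convexHull ℝ (F : Set (Fin m → ℝ)), ∃ t > 0, ∀ i, x i + t * v i ≤ y i) :
    ∃ l : Fin m → ℝ, (∀ i, 0 ≤ l i) ∧ 0 < ∑ i, l i * v i ∧
      ∀ y ∈ convexHull ℝ (F : Set (Fin m → ℝ)), ∑ i, l i * y i ≤ ∑ i, l i * x i := by
  classical
  by_contra hcon
  let D : (Fin m → ℝ) → ((Fin m → ℝ) →ₗ[ℝ] ℝ) := fun w => ∑ i, w i • LinearMap.proj i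
  have hD : ∀ w l, D w l = ∑ i, l i * w i := by
    intro w l
    simp [D, mul_comm]
  obtain ⟨c, hc0, hc⟩ := farkas_aux (Finset.univ : Finset (↥F ⊕ Fin m))
    (Sum.elim (fun p => D (p.1 - x)) (fun i => - LinearMap.proj i)) (D v) (by
      intro l hl
      by_contra hpos
      push Not at hpos
      refine hcon ⟨l, fun i => ?_, by rwa [hD] at hpos, fun y hy => ?_⟩
      · have := hl (Sum.inr i) (Finset.mem_univ _)
        simpa using this
      · have hconv : Convex ℝ {y : Fin m → ℝ | D l y ≤ D l x} :=
          convex_halfSpace_le (D l).isLinear _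
        have hsub : (F : Set (Fin m → ℝ)) ⊆ {y : Fin m → ℝ | D l y ≤ D l x} := by
          intro p hp
          have := hl (Sum.inl ⟨p, hp⟩) (Finset.mem_univ _)
          simp only [Sum.elim_inl, hD, Pi.sub_apply, mul_sub, Finset.sum_sub_distrib] at this
          simp only [Set.mem_setOf_eq, hD, mul_comm _ (l _)]
          linarith
        have := convexHull_min hsub hconv hy
        simpa only [Set.mem_setOf_eq, hD, mul_comm _ (l _)] using this)
  have key : ∀ i, v i = ∑ p : ↥F, c (Sum.inl p) * (p.1 i - x i) - c (Sum.inr i) := by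
    intro i
    have := hc (Pi.single i 1)
    simp only [Fintype.sum_sum_type, Sum.elim_inl, Sum.elim_inr, hD] at this
    simpa [Pi.single_apply, sub_eq_add_neg] using this
  set A := ∑ p : ↥F, c (Sum.inl p) with hA
  have hA0 : 0 ≤ A := Finset.sum_nonneg fun p _ => hc0 _
  rcases hA0.eq_or_lt with h0 | hpos
  · obtain ⟨j, hj⟩ := hv'
    have hz := (Finset.sum_eq_zero_iff_of_nonneg (fun p _ => hc0 (Sum.inl p))).1 h0.symm
    have := key j
    rw [Finset.sum_eq_zero (fun p hp => by rw [hz p hp, zero_mul])] at this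
    have := hc0 (Sum.inr j)
    linarith
  · refine hno ⟨∑ p : ↥F, (A⁻¹ * c (Sum.inl p)) • p.1, ?_, A⁻¹, inv_pos.2 hpos, fun i => ?_⟩
    · refine (convex_convexHull ℝ _).sum_mem (fun p _ => ?_) ?_ (fun p _ => ?_)
      · exact mul_nonneg (inv_pos.2 hpos).le (hc0 _)
      · rw [← Finset.mul_sum, ← hA, inv_mul_cancel₀ hpos.ne']
      · exact subset_convexHull ℝ _ p.2
    · have h1 := key i
      simp only [mul_sub, Finset.sum_sub_distrib, ← Finset.sum_mul, ← hA] at h1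
      simp only [Finset.sum_apply, Pi.smul_apply, smul_eq_mul, mul_assoc, ← Finset.mul_sum]
      have h2 := hc0 (Sum.inr i)
      have h3 : A⁻¹ * (A * x i + v i) ≤ A⁻¹ * ∑ p : ↥F, c (Sum.inl p) * p.1 i :=
        mul_le_mul_of_nonneg_left (by linarith) (inv_pos.2 hpos).le
      rwa [mul_add, inv_mul_cancel_left₀ hpos.ne'] at h3

/-- Normalizing nonnegative weights. -/
theorem normalize_aux {Pol : Type*} {m : ℕ} (f : Pol → Fin m → ℝ) (π : Pol) (l : Fin m → ℝ)
    (h0 : ∀ i, 0 ≤ l i) (hs : 0 < ∑ i, l i)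
    (hmax : ∀ π' : Pol, ∑ i, l i * f π' i ≤ ∑ i, l i * f π i) :
    (fun i => (∑ i, l i)⁻¹ * l i) ∈ stdSimplex ℝ (Fin m) ∧
    ∀ π' : Pol, ∑ i, ((∑ i, l i)⁻¹ * l i) * f π' i ≤ ∑ i, ((∑ i, l i)⁻¹ * l i) * f π i := by
  refine ⟨⟨fun i => mul_nonneg (inv_pos.2 hs).le (h0 i), ?_⟩, fun π' => ?_⟩
  · rw [← Finset.mul_sum, inv_mul_cancel₀ hs.ne']
  · simp only [mul_assoc, ← Finset.mul_sum]
    exact mul_le_mul_of_nonneg_left (hmax π') (inv_pos.2 hs).le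

/-- If the image of the objective-value map is a convex polytope, then the policies
maximizing some linear scalarization with weights in the simplex are exactly the
weakly Pareto optimal ones, and the policies maximizing some linear scalarization
with strictly positive weights are exactly the Pareto optimal ones. -/
theorem linear_scalarization_covers_pareto_of_polytope
    {Pol : Type*} [Nonempty Pol] {m : ℕ} (hm : 1 ≤ m) (f : Pol → Fin m → ℝ)
    (hpoly : ∃ F : Finset (Fin m → ℝ),
      Set.range f = convexHull ℝ (F : Set (Fin m → ℝ))) :
    ({π : Pol | ∃ lam ∈ stdSimplex ℝ (Fin m),
        ∀ π' : Pol, ∑ i, lam i * f π' i ≤ ∑ i, lam i * f π i}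
      = {π : Pol | WeaklyParetoOptimal f π}) ∧
    ({π : Pol | ∃ lam ∈ stdSimplex ℝ (Fin m), (∀ i, 0 < lam i) ∧
        ∀ π' : Pol, ∑ i, lam i * f π' i ≤ ∑ i, lam i * f π i}
      = {π : Pol | ParetoOptimal f π}) := by
  classical
  obtain ⟨F, hF⟩ := hpoly
  have hmem : ∀ π', f π' ∈ convexHull ℝ (F : Set (Fin m → ℝ)) := fun π' => hF ▸ ⟨π', rfl⟩
  constructor
  · ext π
    simp only [Set.mem_setOf_eq]
    constructor
    · rintro ⟨l, ⟨hl0, hl1⟩, hmax⟩ ⟨π', hπ'⟩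
      refine absurd (hmax π') (not_le.2 ?_)
      refine Finset.sum_lt_sum (fun i _ => mul_le_mul_of_nonneg_left (hπ' i).le (hl0 i)) ?_
      obtain ⟨j, hj, hj'⟩ : ∃ j ∈ Finset.univ, 0 < l j := by
        by_contra hne
        push Not at hne
        have := Finset.sum_nonpos hne
        linarith
      exact ⟨j, hj, mul_lt_mul_of_pos_left (hπ' j) hj'⟩
    · intro hw
      obtain ⟨l, hl0, hl1, hl⟩ := scalar_aux F (f π) (fun _ => 1) (fun _ => zero_le_one)
        ⟨⟨0, hm⟩, zero_lt_one⟩ (by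
          rintro ⟨y, hy, t, ht, hty⟩
          rw [← hF] at hy
          obtain ⟨π', rfl⟩ := hy
          exact hw ⟨π', fun i => by have := hty i; linarith⟩)
      simp only [mul_one] at hl1
      obtain ⟨h1, h2⟩ := normalize_aux f π l hl0 hl1 (fun π' => hl _ (hmem π'))
      exact ⟨_, h1, h2⟩
  · ext π
    simp only [Set.mem_setOf_eq]
    constructor
    · rintro ⟨l, -, hl0, hmax⟩ ⟨π', hπ', j, hj⟩
      refine absurd (hmax π') (not_le.2 ?_)
      exact Finset.sum_lt_sum (fun i _ => mul_le_mul_of_nonneg_left (hπ' i) (hl0 i).le)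
        ⟨j, Finset.mem_univ _, mul_lt_mul_of_pos_left hj (hl0 j)⟩
    · intro hp
      have hex := fun j : Fin m => scalar_aux F (f π) (Pi.single j 1)
        (fun i => by rw [Pi.single_apply]; split_ifs <;> norm_num)
        ⟨j, by simp⟩ (by
          rintro ⟨y, hy, t, ht, hty⟩
          rw [← hF] at hy
          obtain ⟨π', rfl⟩ := hy
          refine hp ⟨π', fun i => ?_, j, ?_⟩
          · have h1 := hty i
            rw [Pi.single_apply] at h1
            split_ifs at h1 <;> linarith
          · have h1 := hty j
            rw [Pi.single_eq_same] at h1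
            linarith)
      choose L hL0 hL1 hL using hex
      have hL1' : ∀ j, 0 < L j j := fun j => by simpa [Pi.single_apply] using hL1 j
      let l : Fin m → ℝ := fun i => ∑ j, L j i
      have hl : ∀ i, 0 < l i := fun i =>
        Finset.sum_pos' (fun j _ => hL0 j i) ⟨i, Finset.mem_univ _, hL1' i⟩
      have hs : 0 < ∑ i, l i := Finset.sum_pos (fun i _ => hl i) ⟨⟨0, hm⟩, Finset.mem_univ _⟩
      have hsw : ∀ y : Fin m → ℝ, ∑ i, l i * y i = ∑ j, ∑ i, L j i * y i := by
        intro y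
        simp only [l, Finset.sum_mul]
        exact Finset.sum_comm
      obtain ⟨h1, h2⟩ := normalize_aux f π l (fun i => (hl i).le) hs (fun π' => by
        rw [hsw, hsw]
        exact Finset.sum_le_sum fun j _ => hL j _ (hmem π'))
      exact ⟨_, h1, fun i => mul_pos (inv_pos.2 hs) (hl i), h2⟩
end

section
/- Suppose Π is a nonempty compact topological space and f : Π → ℝ^m is continuous. Then { π ∈ Π : PSG(π) = 0 } = Π_W, i.e., a policy has Pareto suboptimality gap zero if and only if it is weakly Pareto optimal. -/
/-- The Pareto suboptimality gap of a policy `π`. -/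
noncomputable def PSG {Pol : Type*} {m : ℕ} (f : Pol → Fin m → ℝ) (π : Pol) : ℝ :=
  sInf {ε : ℝ | 0 ≤ ε ∧ ∀ πs : Pol, ParetoOptimal f πs →
    ((∃ i, f πs i < f π i + ε) ∨ (∀ i, f π i + ε = f πs i))}

/-- The zeros of the Pareto suboptimality gap are exactly the weakly Pareto
optimal policies. -/
theorem psg_zero_iff_weak_pareto
    {Pol : Type*} [TopologicalSpace Pol] [CompactSpace Pol] [Nonempty Pol]
    {m : ℕ} (hm : 1 ≤ m) (f : Pol → Fin m → ℝ) (hf : Continuous f) :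
    {π : Pol | PSG f π = 0} = {π : Pol | WeaklyParetoOptimal f π} := by
  ext π
  simp only [Set.mem_setOf_eq]
  have i0 : Fin m := ⟨0, hm⟩
  constructor
  · intro h hw
    obtain ⟨p, hp⟩ := hw
    have hfi : ∀ i, Continuous (fun q => f q i) := fun i => (continuous_apply i).comp hf
    have hcl : IsClosed {q : Pol | ∀ i, f p i ≤ f q i} := by
      simp only [Set.setOf_forall]
      exact isClosed_iInter fun i => isClosed_le continuous_const (hfi i)
    obtain ⟨s, hs, hmax⟩ := hcl.isCompact.exists_isMaxOn ⟨p, fun i => le_refl _⟩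
      (f := fun q => ∑ i, f q i) (continuous_finsetSum _ fun i _ => hfi i).continuousOn
    have hpar : ParetoOptimal f s := by
      rintro ⟨q, hq, j, hj⟩
      have h1 : ∑ i, f q i ≤ ∑ i, f s i := hmax (fun i => (hs i).trans (hq i))
      have h2 : ∑ i, f s i < ∑ i, f q i :=
        Finset.sum_lt_sum (fun i _ => hq i) ⟨j, Finset.mem_univ j, hj⟩
      linarith
    obtain ⟨k, -, hk⟩ := Finset.exists_min_image Finset.univ (fun i => f s i - f π i)
      ⟨i0, Finset.mem_univ _⟩
    have hpos : 0 < f s k - f π k := by linarith [hp k, hs k]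
    obtain ⟨B, hB⟩ := (isCompact_range (hfi i0)).bddAbove
    have hle : f s k - f π k ≤ PSG f π := by
      apply le_csInf
      · refine ⟨max 0 (B - f π i0 + 1), le_max_left _ _, fun q _ => Or.inl ⟨i0, ?_⟩⟩
        have := hB ⟨q, rfl⟩
        have := le_max_right 0 (B - f π i0 + 1)
        simp only at *
        linarith
      · rintro ε ⟨-, hε⟩
        rcases hε s hpar with ⟨i, hi⟩ | hi
        · have := hk i (Finset.mem_univ i)
          linarith
        · linarith [hi k]
    linarith
  · intro h
    apply le_antisymm
    · refine le_of_forall_pos_le_add fun ε hε => ?_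
      rw [zero_add]
      refine csInf_le ⟨0, fun x hx => hx.1⟩ ⟨hε.le, fun q _ => Or.inl ?_⟩
      by_contra hc
      push Not at hc
      exact h ⟨q, fun i => by linarith [hc i]⟩
    · exact Real.sInf_nonneg fun x hx => hx.1
end

section
/- Assume each f_i attains its maximum V_i^* over Π and fix ι > 0. Let π̄ ∈ Π be Pareto optimal and define λ ∈ Δ_m^o by λ_i := (V_i^* + ι − f_i(π̄))^{-1} / Σ_{j=1}^m (V_j^* + ι − f_j(π̄))^{-1} (note V_i^* + ι − f_i(π̄) > 0 for each i). Then (i) π̄ minimizes TCH_λ over Π, and (ii) every minimizer π̃ of TCH_λ over Π is Pareto optimal and satisfies f_i(π̃) = f_i(π̄) for all i ∈ {1,…,m}. -/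
/-- The Tchebycheff scalarization `TCH_λ(π) = max_i λ_i (V_i^* + ι − f_i(π))`. -/
noncomputable def TCH {Pol : Type*} {m : ℕ} (Vstar : Fin m → ℝ) (ι : ℝ)
    (f : Pol → Fin m → ℝ) (lam : Fin m → ℝ) (π : Pol) : ℝ :=
  sSup (Set.range fun i => lam i * (Vstar i + ι - f π i))

/-- For a Pareto optimal policy `π̄` and the preference vector
`λ_i = (V_i^* + ι − f_i(π̄))⁻¹ / ∑ j (V_j^* + ι − f_j(π̄))⁻¹` (which lies in the
relative interior of the simplex), `π̄` minimizes `TCH_λ`, and every minimizer of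
`TCH_λ` is Pareto optimal with the same objective values as `π̄`. -/
theorem tch_pareto_minimizers_all_equal
    {Pol : Type*} [Nonempty Pol] {m : ℕ} (hm : 1 ≤ m) (f : Pol → Fin m → ℝ)
    (Vstar : Fin m → ℝ)
    (hV : ∀ i, IsGreatest (Set.range fun π : Pol => f π i) (Vstar i))
    (ι : ℝ) (hι : 0 < ι)
    (πbar : Pol) (hpar : ParetoOptimal f πbar)
    (lam : Fin m → ℝ)
    (hlam : ∀ i, lam i =
      (Vstar i + ι - f πbar i)⁻¹ / ∑ j, (Vstar j + ι - f πbar j)⁻¹) :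
    (lam ∈ stdSimplex ℝ (Fin m) ∧ ∀ i, 0 < lam i) ∧
    (∀ π' : Pol, TCH Vstar ι f lam πbar ≤ TCH Vstar ι f lam π') ∧
    (∀ πt : Pol, (∀ π' : Pol, TCH Vstar ι f lam πt ≤ TCH Vstar ι f lam π') →
        ParetoOptimal f πt ∧ ∀ i, f πt i = f πbar i) := by
  haveI : Nonempty (Fin m) := ⟨⟨0, hm⟩⟩
  have hd : ∀ i, 0 < Vstar i + ι - f πbar i := fun i => by
    have := (hV i).2 ⟨πbar, rfl⟩
    simp only at this
    linarith
  have hS : 0 < ∑ j, (Vstar j + ι - f πbar j)⁻¹ :=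
    Finset.sum_pos (fun i _ => inv_pos.2 (hd i)) Finset.univ_nonempty
  have hpos : ∀ i, 0 < lam i := fun i => by
    rw [hlam i]
    exact div_pos (inv_pos.2 (hd i)) hS
  have hc : ∀ i, lam i * (Vstar i + ι - f πbar i) = (∑ j, (Vstar j + ι - f πbar j)⁻¹)⁻¹ := by
    intro i
    rw [hlam i, div_mul_eq_mul_div, inv_mul_cancel₀ (hd i).ne', one_div]
  have hbar : TCH Vstar ι f lam πbar = (∑ j, (Vstar j + ι - f πbar j)⁻¹)⁻¹ := by
    unfold TCH
    simp only [hc, Set.range_const, csSup_singleton]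
  have key : ∀ p : Pol, TCH Vstar ι f lam p ≤ TCH Vstar ι f lam πbar →
      ∀ i, f p i = f πbar i := by
    intro p hp
    have hge : ∀ i, f πbar i ≤ f p i := by
      intro i
      have h1 : lam i * (Vstar i + ι - f p i) ≤ TCH Vstar ι f lam p :=
        le_csSup (Set.finite_range _).bddAbove ⟨i, rfl⟩
      have h2 : lam i * (Vstar i + ι - f p i) ≤ lam i * (Vstar i + ι - f πbar i) := by
        rw [hc i, ← hbar]
        exact h1.trans hp
      have h3 := le_of_mul_le_mul_left h2 (hpos i)
      linarith
    intro i
    by_contra hne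
    exact hpar ⟨p, hge, i, lt_of_le_of_ne (hge i) (Ne.symm hne)⟩
  refine ⟨⟨⟨fun i => (hpos i).le, ?_⟩, hpos⟩, ?_, ?_⟩
  · simp only [hlam]
    rw [← Finset.sum_div, div_self hS.ne']
  · intro p
    by_contra! h
    have he := key p h.le
    refine h.ne ?_
    unfold TCH
    simp only [he]
  · intro p hp
    have he := key p (hp πbar)
    refine ⟨?_, he⟩
    rintro ⟨q, hq, j, hj⟩
    exact hpar ⟨q, fun i => (he i) ▸ hq i, j, (he j) ▸ hj⟩
end

section
/- Assume each f_i attains its maximum V_i^* over Π and fix ι > 0 and μ > 0. Let λ ∈ Δ_m and suppose π ∈ Π minimizes STCH_λ^μ over Π (i.e., STCH_λ^μ(π) ≤ STCH_λ^μ(π') for all π' ∈ Π). Then π is weakly Pareto optimal; if moreover λ ∈ Δ_m^o, then π is Pareto optimal. -/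
/-- The smooth Tchebycheff scalarization
`STCH_λ^μ(π) = μ log ∑ i exp (λ_i (V_i^* + ι − f_i(π)) / μ)`. -/
noncomputable def STCH {Pol : Type*} {m : ℕ} (Vstar : Fin m → ℝ) (ι μ : ℝ)
    (f : Pol → Fin m → ℝ) (lam : Fin m → ℝ) (π : Pol) : ℝ :=
  μ * Real.log (∑ i, Real.exp (lam i * (Vstar i + ι - f π i) / μ))

/-- A minimizer of the smooth Tchebycheff scalarization for a preference vector in
the simplex is weakly Pareto optimal; if moreover the preference vector is
strictly positive, it is Pareto optimal. -/
theorem stch_minimizer_pareto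
    {Pol : Type*} [Nonempty Pol] {m : ℕ} (hm : 1 ≤ m) (f : Pol → Fin m → ℝ)
    (Vstar : Fin m → ℝ)
    (hV : ∀ i, IsGreatest (Set.range fun π : Pol => f π i) (Vstar i))
    (ι : ℝ) (hι : 0 < ι) (μ : ℝ) (hμ : 0 < μ)
    (lam : Fin m → ℝ) (hlam : lam ∈ stdSimplex ℝ (Fin m)) (π : Pol)
    (hmin : ∀ π' : Pol, STCH Vstar ι μ f lam π ≤ STCH Vstar ι μ f lam π') :
    WeaklyParetoOptimal f π ∧ ((∀ i, 0 < lam i) → ParetoOptimal f π) := by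
  have key : ∀ π' : Pol, (∀ i, f π i ≤ f π' i) → ∀ j, f π j < f π' j → 0 < lam j → False := by
    intro π' hle j hj hlj
    have hlt : ∑ i, Real.exp (lam i * (Vstar i + ι - f π' i) / μ)
        < ∑ i, Real.exp (lam i * (Vstar i + ι - f π i) / μ) := by
      apply Finset.sum_lt_sum
      · intro i _
        apply Real.exp_le_exp.mpr
        apply div_le_div_of_nonneg_right _ hμ.le
        exact mul_le_mul_of_nonneg_left (by linarith [hle i]) (hlam.1 i)
      · refine ⟨j, Finset.mem_univ j, ?_⟩
        apply Real.exp_lt_exp.mpr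
        apply div_lt_div_of_pos_right _ hμ
        exact mul_lt_mul_of_pos_left (by linarith) hlj
    have hpos : 0 < ∑ i, Real.exp (lam i * (Vstar i + ι - f π' i) / μ) :=
      Finset.sum_pos (fun i _ => Real.exp_pos _) ⟨j, Finset.mem_univ j⟩
    have h := hmin π'
    unfold STCH at h
    exact absurd h (not_le.mpr (mul_lt_mul_of_pos_left (Real.log_lt_log hpos hlt) hμ))
  constructor
  · rintro ⟨π', h⟩
    have hex : ∃ j, 0 < lam j := by
      by_contra hcon
      push Not at hcon
      have h1 := Finset.sum_nonpos (fun i (_ : i ∈ Finset.univ) => hcon i)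
      linarith [hlam.2]
    obtain ⟨j, hj⟩ := hex
    exact key π' (fun i => (h i).le) j (h j) hj
  · rintro hl ⟨π', hle, j, hj⟩
    exact key π' hle j hj (hl j)
end

section
/- Suppose Π is finite and nonempty and fix ι > 0. Then there exists μ* > 0 such that for every μ with 0 < μ < μ*, { π ∈ Π : there exists λ ∈ Δ_m^o such that π minimizes STCH_λ^μ over Π } = Π_P, i.e., the minimizers of the smooth Tchebycheff scalarization over all strictly positive preference vectors are exactly the Pareto optimal policies. -/
/-- For a finite policy class there is a threshold `μ* > 0` such that for every
smoothing parameter `0 < μ < μ*`, the minimizers of the smooth Tchebycheff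
scalarization over all strictly positive preference vectors are exactly the
Pareto optimal policies. -/
theorem stch_small_mu_minimizers_eq_pareto
    {Pol : Type*} [Finite Pol] [Nonempty Pol] {m : ℕ} (hm : 1 ≤ m)
    (f : Pol → Fin m → ℝ)
    (Vstar : Fin m → ℝ)
    (hV : ∀ i, IsGreatest (Set.range fun π : Pol => f π i) (Vstar i))
    (ι : ℝ) (hι : 0 < ι) :
    ∃ μstar : ℝ, 0 < μstar ∧ ∀ μ : ℝ, 0 < μ → μ < μstar →
      {π : Pol | ∃ lam ∈ stdSimplex ℝ (Fin m), (∀ i, 0 < lam i) ∧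
          ∀ π' : Pol, STCH Vstar ι μ f lam π ≤ STCH Vstar ι μ f lam π'}
        = {π : Pol | ParetoOptimal f π} := by
  classical
  haveI : Nonempty (Fin m) := ⟨⟨0, hm⟩⟩
  have hg : ∀ π i, 0 < Vstar i + ι - f π i := by
    intro π i
    have h := (hV i).2 ⟨π, rfl⟩
    simp only at h
    linarith
  have hS : ∀ π, 0 < ∑ j, (Vstar j + ι - f π j)⁻¹ := fun π =>
    Finset.sum_pos (fun j _ => inv_pos.2 (hg π j)) Finset.univ_nonempty
  obtain ⟨L, hL⟩ : ∃ L : Pol → Fin m → ℝ, ∀ π i, L π i =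
      (Vstar i + ι - f π i)⁻¹ / ∑ j, (Vstar j + ι - f π j)⁻¹ := ⟨_, fun _ _ => rfl⟩
  have hLpos : ∀ π i, 0 < L π i := fun π i => by
    rw [hL]; exact div_pos (inv_pos.2 (hg π i)) (hS π)
  have hLsum : ∀ π, ∑ i, L π i = 1 := fun π => by
    simp only [hL]
    rw [← Finset.sum_div, div_self (hS π).ne']
  have hLg : ∀ π i, L π i * (Vstar i + ι - f π i) = 1 / ∑ j, (Vstar j + ι - f π j)⁻¹ :=
    fun π i => by
      rw [hL, div_mul_eq_mul_div, inv_mul_cancel₀ (hg π i).ne']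
  have hmpos : (0 : ℝ) < m := by exact_mod_cast hm
  have hev : ∀ᶠ μ : ℝ in nhdsWithin 0 (Set.Ioi 0), ∀ π π' : Pol, ∀ j : Fin m,
      f π' j < f π j → μ * Real.log m ≤ L π j * (f π j - f π' j) := by
    rw [Filter.eventually_all]; intro π
    rw [Filter.eventually_all]; intro π'
    rw [Filter.eventually_all]; intro j
    by_cases h : f π' j < f π j
    · have hp : 0 < L π j * (f π j - f π' j) := mul_pos (hLpos π j) (sub_pos.2 h)
      have ht : Filter.Tendsto (fun μ : ℝ => μ * Real.log m) (nhdsWithin 0 (Set.Ioi 0))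
          (nhds (0 * Real.log m)) :=
        ((continuous_id.mul continuous_const).tendsto (0 : ℝ)).mono_left nhdsWithin_le_nhds
      rw [zero_mul] at ht
      filter_upwards [ht.eventually_lt_const hp] with μ hμ _
      exact hμ.le
    · exact Filter.Eventually.of_forall fun μ h' => absurd h' h
  obtain ⟨u, hu, hsub⟩ := mem_nhdsGT_iff_exists_Ioo_subset.1 hev
  refine ⟨u, hu, fun μ hμ hμu => ?_⟩
  have hμ' := hsub ⟨hμ, hμu⟩
  simp only [Set.mem_setOf_eq] at hμ'
  have hpos : ∀ (lam : Fin m → ℝ) (π : Pol),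
      0 < ∑ i, Real.exp (lam i * (Vstar i + ι - f π i) / μ) := fun lam π =>
    Finset.sum_pos (fun j _ => Real.exp_pos _) Finset.univ_nonempty
  ext π
  simp only [Set.mem_setOf_eq]
  constructor
  · rintro ⟨lam, -, hlam, hmin⟩ ⟨π', hle, j, hj⟩
    refine absurd (hmin π') (not_le.2 ?_)
    unfold STCH
    refine mul_lt_mul_of_pos_left (Real.log_lt_log (hpos _ _) ?_) hμ
    refine Finset.sum_lt_sum (fun i _ => ?_) ⟨j, Finset.mem_univ _, ?_⟩
    · refine Real.exp_le_exp.2 (div_le_div_of_nonneg_right ?_ hμ.le)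
      exact mul_le_mul_of_nonneg_left (by linarith [hle i]) (hlam i).le
    · refine Real.exp_lt_exp.2 (div_lt_div_of_pos_right ?_ hμ)
      exact mul_lt_mul_of_pos_left (by linarith) (hlam j)
  · intro hP
    refine ⟨L π, ⟨fun i => (hLpos π i).le, hLsum π⟩, hLpos π, fun π' => ?_⟩
    unfold STCH
    refine mul_le_mul_of_nonneg_left (Real.log_le_log (hpos _ _) ?_) hμ.le
    by_cases hex : ∃ j, f π' j < f π j
    · obtain ⟨j, hj⟩ := hex
      have h1 := hμ' π π' j hj
      refine le_trans ?_ (Finset.single_le_sum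
        (f := fun i => Real.exp (L π i * (Vstar i + ι - f π' i) / μ))
        (fun i _ => (Real.exp_pos _).le) (Finset.mem_univ j))
      simp only [hLg]
      rw [Finset.sum_const, Finset.card_univ, Fintype.card_fin, nsmul_eq_mul]
      nth_rewrite 1 [← Real.exp_log hmpos]
      rw [← Real.exp_add, ← hLg π j]
      refine Real.exp_le_exp.2 ?_
      rw [le_div_iff₀ hμ, add_mul, div_mul_cancel₀ _ hμ.ne']
      linarith
    · push Not at hex
      refine Finset.sum_le_sum fun i _ => ?_
      have : f π' i = f π i := by
        refine le_antisymm (not_lt.1 fun hlt => hP ⟨π', hex, i, hlt⟩) (hex i)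
      rw [this]
end

section
/- Suppose the image f(Π) ⊆ ℝ^m is a convex polytope (the convex hull of a finite set of points), each f_i attains its maximum V_i^* over Π, and fix ι > 0. Then for every μ > 0: { π ∈ Π : there exists λ ∈ Δ_m^o such that π minimizes STCH_λ^μ over Π } = Π_P, and { π ∈ Π : there exists λ ∈ Δ_m such that π minimizes STCH_λ^μ over Π } = Π_W. -/
open Finset in
/-- Conic Caratheodory. -/
theorem conic_caratheodory {κ E : Type*} [DecidableEq κ] [AddCommGroup E] [Module ℝ E] (v : κ → E) :
    ∀ (s : Finset κ) (c : κ → ℝ), (∀ i ∈ s, 0 ≤ c i) →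
      ∃ t : Finset κ, LinearIndependent ℝ (fun i : t => v i) ∧
        ∃ d : κ → ℝ, (∀ i ∈ t, 0 ≤ d i) ∧ ∑ i ∈ s, c i • v i = ∑ i ∈ t, d i • v i := by
  intro s
  induction s using Finset.strongInduction with
  | H s ih =>
    intro c hc
    by_cases hli : LinearIndependent ℝ (fun i : s => v i)
    · exact ⟨s, hli, c, hc, rfl⟩
    have hg : ∃ g : κ → ℝ, ∑ i ∈ s, g i • v i = 0 ∧ ∃ i ∈ s, 0 < g i := by
      rw [Fintype.linearIndependent_iff] at hli
      push Not at hli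
      obtain ⟨g, hg, i, hi⟩ := hli
      let g' : κ → ℝ := fun k => if h : k ∈ s then g ⟨k, h⟩ else 0
      have hg' : ∑ i ∈ s, g' i • v i = 0 := by
        rw [← hg, ← Finset.sum_coe_sort]
        refine Finset.sum_congr rfl fun k _ => ?_
        simp [g']
      have hgi : g' i = g i := by simp [g']
      rcases lt_or_gt_of_ne hi with h | h
      · refine ⟨fun k => - g' k, ?_, i, i.2, ?_⟩
        · simp [hg']
        · simp only [hgi]; linarith
      · exact ⟨g', hg', i, i.2, by rw [hgi]; exact h⟩
    obtain ⟨g, hg0, i, his, hi⟩ := hg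
    obtain ⟨j, hj, hmin⟩ := Finset.exists_min_image (s.filter fun k => 0 < g k)
      (fun k => c k / g k) ⟨i, by simp [his, hi]⟩
    rw [Finset.mem_filter] at hj
    obtain ⟨hjs, hgj⟩ := hj
    have ht : 0 ≤ c j / g j := div_nonneg (hc j hjs) hgj.le
    let d : κ → ℝ := fun k => c k - c j / g j * g k
    have hd : ∀ k ∈ s, 0 ≤ d k := by
      intro k hk
      by_cases hgk : 0 < g k
      · have := hmin k (by simp [hk, hgk])
        rw [le_div_iff₀ hgk] at this
        simp only [d]; linarith
      · have h1 : c j / g j * g k ≤ 0 := mul_nonpos_of_nonneg_of_nonpos ht (not_lt.mp hgk)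
        have := hc k hk
        simp only [d]; linarith
    have hdj : d j = 0 := by simp only [d]; field_simp; ring
    obtain ⟨t, h1, e, h2, h3⟩ := ih (s.erase j) (Finset.erase_ssubset hjs) d
      (fun k hk => hd k (Finset.mem_of_mem_erase hk))
    refine ⟨t, h1, e, h2, ?_⟩
    rw [← h3, Finset.sum_erase _ (by simp [hdj])]
    simp only [d, sub_smul, Finset.sum_sub_distrib, mul_smul, ← Finset.smul_sum, hg0]
    simp

theorem fg_cone_closed {m : ℕ} {κ : Type*} [Fintype κ] (v : κ → Fin m → ℝ) :
    IsClosed {x : Fin m → ℝ | ∃ c : κ → ℝ, (∀ i, 0 ≤ c i) ∧ x = ∑ i, c i • v i} := by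
  classical
  have key : {x : Fin m → ℝ | ∃ c : κ → ℝ, (∀ i, 0 ≤ c i) ∧ x = ∑ i, c i • v i} =
      ⋃ t ∈ {t : Finset κ | LinearIndependent ℝ (fun i : t => v i)},
        (Fintype.linearCombination ℝ (fun i : t => v i)) '' {c | ∀ i, 0 ≤ c i} := by
    ext x
    simp only [Set.mem_setOf_eq, Set.mem_iUnion, Set.mem_image, exists_prop,
      Fintype.linearCombination_apply]
    constructor
    · rintro ⟨c, hc, rfl⟩
      obtain ⟨t, h1, d, h2, h3⟩ := conic_caratheodory v Finset.univ c (fun i _ => hc i)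
      refine ⟨t, h1, fun i => d i, fun i => h2 i i.2, ?_⟩
      rw [h3]
      exact Finset.sum_coe_sort t (fun i => d i • v i)
    · rintro ⟨t, -, c, hc, rfl⟩
      refine ⟨fun k => if h : k ∈ t then c ⟨k, h⟩ else 0, fun k => ?_, ?_⟩
      · dsimp only; split_ifs
        · exact hc _
        · exact le_rfl
      · rw [← Finset.sum_subset (Finset.subset_univ t), ← Finset.sum_coe_sort t]
        · refine Finset.sum_congr rfl fun k _ => ?_
          simp
        · intro k _ hk
          simp [hk]
  rw [key]
  refine (Set.toFinite _).isClosed_biUnion fun t ht => ?_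
  have hinj : LinearMap.ker (Fintype.linearCombination ℝ (fun i : t => v i)) = ⊥ :=
    LinearMap.ker_eq_bot.mpr (LinearIndependent.fintypeLinearCombination_injective ht)
  refine (LinearMap.isClosedEmbedding_of_injective hinj).isClosedMap _ ?_
  simp only [Set.setOf_forall]
  exact isClosed_iInter fun i => isClosed_le continuous_const (continuous_apply i)

theorem functional_eq {m : ℕ} (g : (Fin m → ℝ) →L[ℝ] ℝ) (x : Fin m → ℝ) :
    g x = ∑ i, x i * g (Pi.single i 1) := by
  have := LinearMap.pi_apply_eq_sum_univ g.toLinearMap x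
  simp only [smul_eq_mul, ContinuousLinearMap.coe_coe] at this
  rw [this]
  refine Finset.sum_congr rfl fun i _ => ?_
  congr 2
  ext j
  simp [Pi.single_apply, eq_comm]

theorem strict_weights {m : ℕ} (F : Finset (Fin m → ℝ)) (y0 : Fin m → ℝ)
    (hP : ∀ y ∈ convexHull ℝ (F : Set (Fin m → ℝ)), (∀ i, y0 i ≤ y i) → y = y0) :
    ∃ w : Fin m → ℝ, (∀ i, 0 < w i) ∧
      ∀ y ∈ convexHull ℝ (F : Set (Fin m → ℝ)), ∑ i, w i * y i ≤ ∑ i, w i * y0 i := by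
  classical
  set K := {x : Fin m → ℝ | ∃ c : F → ℝ, (∀ i, 0 ≤ c i) ∧ x = ∑ i, c i • (i.1 - y0)} with hK
  have hKc : IsClosed K := fg_cone_closed (fun i : F => i.1 - y0)
  have hKconv : Convex ℝ K := by
    rintro x ⟨c, hc, rfl⟩ y ⟨d, hd, rfl⟩ a b ha hb _
    refine ⟨fun i => a * c i + b * d i, fun i => ?_, ?_⟩
    · have := hc i; have := hd i; positivity
    · simp only [Finset.smul_sum, ← Finset.sum_add_distrib, add_smul, mul_smul]
  have hdisj : Disjoint (stdSimplex ℝ (Fin m)) K := by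
    rw [Set.disjoint_left]
    rintro s ⟨hs0, hs1⟩ ⟨c, hc, hsc⟩
    have hC0 : 0 ≤ ∑ i, c i := Finset.sum_nonneg fun i _ => hc i
    rcases hC0.eq_or_lt with h | hC
    · have h0 := (Finset.sum_eq_zero_iff_of_nonneg (fun i _ => hc i)).mp h.symm
      have : s = 0 := by
        rw [hsc]; exact Finset.sum_eq_zero fun i hi => by rw [h0 i hi, zero_smul]
      simp [this] at hs1
    · set C := ∑ i, c i with hCdef
      have hmem : (∑ i : F, (c i / C) • i.1) ∈ convexHull ℝ (F : Set (Fin m → ℝ)) := by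
        refine (convex_convexHull ℝ _).sum_mem (fun i _ => div_nonneg (hc i) hC0) ?_
          (fun i _ => subset_convexHull ℝ _ i.2)
        rw [← Finset.sum_div, ← hCdef, div_self hC.ne']
      have heq : (∑ i : F, (c i / C) • i.1) = y0 + C⁻¹ • s := by
        rw [hsc]
        simp only [smul_sub, Finset.sum_sub_distrib, ← Finset.sum_smul, ← hCdef, Finset.smul_sum,
          smul_smul]
        rw [inv_mul_cancel₀ hC.ne', one_smul]
        simp only [div_eq_inv_mul]
        abel
      rw [heq] at hmem
      have h1 := hP _ hmem (fun i => by
        have := hs0 i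
        have : 0 ≤ C⁻¹ * s i := by positivity
        simp only [Pi.add_apply, Pi.smul_apply, smul_eq_mul]; linarith)
      have h2 : C⁻¹ • s = 0 := by simpa using h1
      rcases smul_eq_zero.mp h2 with h3 | h3
      · exact (inv_ne_zero hC.ne') h3
      · simp [h3] at hs1
  obtain ⟨g, u, v, h1, huv, h2⟩ := geometric_hahn_banach_compact_closed
    (convex_stdSimplex ℝ (Fin m)) (isCompact_stdSimplex ℝ (Fin m)) hKconv hKc hdisj
  have hv : v < 0 := by
    have := h2 0 ⟨0, by simp, by simp⟩
    simpa using this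
  have hw : ∀ i, g (Pi.single i 1) < 0 := fun i => by
    have := h1 _ (single_mem_stdSimplex ℝ i); linarith
  have hpos : ∀ b ∈ K, 0 ≤ g b := by
    rintro b ⟨c, hc, hb⟩
    by_contra hneg
    push Not at hneg
    have := h2 ((v / g b) • b) ⟨fun i => v / g b * c i, fun i =>
      mul_nonneg (div_nonneg_of_nonpos hv.le hneg.le) (hc i), by
        rw [hb]; simp only [Finset.smul_sum, mul_smul]⟩
    rw [map_smul, smul_eq_mul, div_mul_cancel₀ _ hneg.ne] at this
    exact lt_irrefl _ this
  refine ⟨fun i => - g (Pi.single i 1), fun i => by have := hw i; linarith, fun y hy => ?_⟩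
  have hrepr : ∀ x : Fin m → ℝ, ∑ i, - g (Pi.single i 1) * x i = - g x := fun x => by
    rw [functional_eq g x, ← Finset.sum_neg_distrib]
    exact Finset.sum_congr rfl fun i _ => by ring
  rw [hrepr, hrepr, neg_le_neg_iff]
  have hsub : convexHull ℝ (F : Set (Fin m → ℝ)) ⊆ {y | g y0 ≤ g y} := by
    refine convexHull_min (fun z hz => ?_) (convex_halfSpace_ge g.toLinearMap.isLinear _)
    have := hpos (z - y0) ⟨Pi.single ⟨z, hz⟩ 1, fun i => by
      by_cases h : i = ⟨z, hz⟩
      · subst h; simp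
      · simp [Pi.single_apply, h], by
      rw [Finset.sum_eq_single ⟨z, hz⟩] <;> simp +contextual [Pi.single_apply]⟩
    rw [map_sub] at this
    simp only [Set.mem_setOf_eq]; linarith
  exact hsub hy

theorem weak_weights {m : ℕ} (hm : 1 ≤ m) (P : Set (Fin m → ℝ)) (hPc : Convex ℝ P)
    (y0 : Fin m → ℝ) (hy0 : y0 ∈ P) (hP : ∀ y ∈ P, ¬ ∀ i, y0 i < y i) :
    ∃ w : Fin m → ℝ, (∀ i, 0 ≤ w i) ∧ (∃ i, 0 < w i) ∧
      ∀ y ∈ P, ∑ i, w i * y i ≤ ∑ i, w i * y0 i := by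
  have hO : IsOpen (Set.univ.pi fun i => Set.Ioi (y0 i)) :=
    isOpen_set_pi Set.finite_univ fun i _ => isOpen_Ioi
  have hOc : Convex ℝ (Set.univ.pi fun i => Set.Ioi (y0 i)) :=
    convex_pi fun i _ => convex_Ioi _
  obtain ⟨g, u, h1, h2⟩ := geometric_hahn_banach_open hOc hO hPc (by
    rw [Set.disjoint_left]
    intro y hy hyP
    exact hP y hyP fun i => hy i (Set.mem_univ i))
  have hneg : ∀ z : Fin m → ℝ, (∀ i, 0 < z i) → g z < 0 := fun z hz => by
    have a := h1 (y0 + z) (fun i _ => by simp [hz i])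
    have b := h2 y0 hy0
    rw [map_add] at a; linarith
  have hle : ∀ z : Fin m → ℝ, (∀ i, 0 ≤ z i) → g z ≤ 0 := fun z hz => by
    refine le_of_forall_pos_lt_add fun ε hε => ?_
    by_contra hcon
    push Not at hcon
    have h1' := hneg (fun _ => 1) (fun _ => one_pos)
    have := hneg (z + (ε / (- 2 * g fun _ => 1)) • (fun _ => 1)) (fun i => by
      have : 0 < ε / (- 2 * g fun _ => 1) := div_pos hε (by linarith)
      have := hz i
      simp only [Pi.add_apply, Pi.smul_apply, smul_eq_mul]; linarith)
    rw [map_add, map_smul, smul_eq_mul] at this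
    have e : ε / (- 2 * g fun _ => 1) * (g fun _ => 1) = - ε / 2 := by
      have := h1'.ne
      field_simp
    rw [e] at this
    linarith
  have hrepr : ∀ x : Fin m → ℝ, ∑ i, - g (Pi.single i 1) * x i = - g x := fun x => by
    rw [functional_eq g x, ← Finset.sum_neg_distrib]
    exact Finset.sum_congr rfl fun i _ => by ring
  have hle1 : ∀ i, g (Pi.single i 1) ≤ 0 := fun i => hle _ fun j => by
    by_cases h : j = i
    · subst h; simp
    · simp [h]
  refine ⟨fun i => - g (Pi.single i 1), fun i => by have := hle1 i; linarith, ?_, fun y hy => ?_⟩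
  · by_contra hcon
    push Not at hcon
    have h1' := hneg (fun _ => 1) (fun _ => one_pos)
    have h3 := hrepr (fun _ => 1)
    have : ∑ i, - g (Pi.single i 1) * (1:ℝ) ≤ 0 := Finset.sum_nonpos fun i _ => by
      have := hcon i; linarith
    linarith
  · rw [hrepr, hrepr, neg_le_neg_iff]
    have hb := h2 y hy
    refine le_trans (le_of_forall_pos_le_add fun ε hε => ?_) hb
    have h1' := hneg (fun _ => 1) (fun _ => one_pos)
    have hp : 0 < ε / (- g fun _ => 1) := div_pos hε (by linarith)
    have := h1 (y0 + (ε / (- g fun _ => 1)) • (fun _ => 1)) (fun i _ => by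
      simp only [Set.mem_Ioi, Pi.add_apply, Pi.smul_apply, smul_eq_mul]; linarith)
    rw [map_add, map_smul, smul_eq_mul] at this
    have e : ε / (- g fun _ => 1) * (g fun _ => 1) = - ε := by
      have := h1'.ne
      field_simp
    rw [e] at this
    linarith

/-- `x ↦ x exp (a |x|)` as an order isomorphism of the line. -/
theorem exists_inverse (a : ℝ) (ha : 0 ≤ a) :
    ∃ e : ℝ ≃o ℝ, ∀ x, e x = x * Real.exp (a * |x|) := by
  have hmono : StrictMono fun x : ℝ => x * Real.exp (a * |x|) := by
    refine strictMono_of_odd_strictMonoOn_nonneg (fun x => by simp) ?_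
    intro x hx y hy hxy
    simp only [Set.mem_Ici] at hx hy
    simp only [abs_of_nonneg hx, abs_of_nonneg hy]
    have h : Real.exp (a * x) ≤ Real.exp (a * y) := by gcongr
    calc x * Real.exp (a * x) ≤ x * Real.exp (a * y) := by gcongr
      _ < y * Real.exp (a * y) := by gcongr
  have hone : ∀ x : ℝ, 1 ≤ Real.exp (a * |x|) := fun x => Real.one_le_exp (by positivity)
  have hsurj : Function.Surjective fun x : ℝ => x * Real.exp (a * |x|) := by
    refine Continuous.surjective (by fun_prop) ?_ ?_
    · refine Filter.tendsto_atTop_mono' _ ?_ Filter.tendsto_id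
      filter_upwards [Filter.eventually_ge_atTop 0] with x hx
      have := hone x
      simp only [id]; nlinarith
    · refine Filter.tendsto_atBot_mono' _ ?_ Filter.tendsto_id
      filter_upwards [Filter.eventually_le_atBot 0] with x hx
      have := hone x
      simp only [id]; nlinarith
  exact ⟨hmono.orderIsoOfSurjective _ hsurj, fun x => rfl⟩

theorem exists_lam {m : ℕ} (a w : Fin m → ℝ) (ha : ∀ i, 0 ≤ a i) (hw : ∀ i, 0 ≤ w i)
    (hw1 : ∃ i, 0 < w i) :
    ∃ lam ∈ stdSimplex ℝ (Fin m), (∀ i, 0 < w i → 0 < lam i) ∧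
      ∃ c : ℝ, 0 ≤ c ∧ ∀ i, lam i * Real.exp (a i * lam i) = c * w i := by
  choose e he using fun i => exists_inverse (a i) (ha i)
  have he0 : ∀ i, (e i).symm 0 = 0 := fun i => by
    rw [OrderIso.symm_apply_eq, he]; simp
  have hnn : ∀ i x, 0 ≤ x → 0 ≤ (e i).symm x := fun i x hx => by
    rw [← he0 i]; exact (e i).symm.monotone hx
  have hcont : Continuous fun c : ℝ => ∑ i, (e i).symm (c * w i) :=
    continuous_finsetSum _ fun i _ => (e i).symm.continuous.comp (by fun_prop)
  obtain ⟨i0, hi0⟩ := hw1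
  have hc1 : 0 ≤ e i0 1 / w i0 := by
    rw [he]; positivity
  have hS1 : 1 ≤ ∑ i, (e i).symm (e i0 1 / w i0 * w i) := by
    have : (e i0).symm (e i0 1 / w i0 * w i0) = 1 := by
      rw [div_mul_cancel₀ _ hi0.ne', OrderIso.symm_apply_apply]
    refine this.symm.le.trans ?_
    exact Finset.single_le_sum (f := fun i => (e i).symm (e i0 1 / w i0 * w i))
      (fun i _ => hnn i _ (mul_nonneg hc1 (hw i))) (Finset.mem_univ i0)
  obtain ⟨c, ⟨hc, -⟩, hS⟩ := intermediate_value_Icc hc1 hcont.continuousOn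
    (show (1:ℝ) ∈ Set.Icc _ _ from ⟨by simp [he0], hS1⟩)
  have hl : ∀ i, 0 ≤ (e i).symm (c * w i) := fun i => hnn i _ (mul_nonneg hc (hw i))
  have hcpos : 0 < c := by
    rcases hc.eq_or_lt with h | h
    · rw [← h] at hS; simp [he0] at hS
    · exact h
  refine ⟨fun i => (e i).symm (c * w i), ⟨hl, hS⟩, fun i hi => ?_, c, hc, fun i => ?_⟩
  · dsimp only
    rw [← he0 i]; exact (e i).symm.strictMono (mul_pos hcpos hi)
  · have := he i ((e i).symm (c * w i))
    rw [OrderIso.apply_symm_apply, abs_of_nonneg (hl i)] at this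
    exact this.symm

theorem exists_lam_min {Pol : Type*} {m : ℕ} (hm : 1 ≤ m) (f : Pol → Fin m → ℝ)
    (Vstar : Fin m → ℝ) (ι : ℝ) (hι : 0 < ι) (μ : ℝ) (hμ : 0 < μ) (π : Pol)
    (hV : ∀ i, f π i ≤ Vstar i) (w : Fin m → ℝ) (hw : ∀ i, 0 ≤ w i) (hw1 : ∃ i, 0 < w i)
    (hmax : ∀ π', ∑ i, w i * f π' i ≤ ∑ i, w i * f π i) :
    ∃ lam ∈ stdSimplex ℝ (Fin m), (∀ i, 0 < w i → 0 < lam i) ∧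
      ∀ π' : Pol, STCH Vstar ι μ f lam π ≤ STCH Vstar ι μ f lam π' := by
  obtain ⟨lam, h1, h2, c, hc, h3⟩ := exists_lam (fun i => (Vstar i + ι - f π i) / μ) w
    (fun i => div_nonneg (by have := hV i; linarith) hμ.le) hw hw1
  refine ⟨lam, h1, h2, fun π' => ?_⟩
  haveI : Nonempty (Fin m) := ⟨⟨0, hm⟩⟩
  refine mul_le_mul_of_nonneg_left (Real.log_le_log
    (Finset.sum_pos (fun i _ => Real.exp_pos _) Finset.univ_nonempty) ?_) hμ.le
  have hterm : ∀ i, Real.exp (lam i * (Vstar i + ι - f π i) / μ) +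
      c / μ * (w i * f π i - w i * f π' i) ≤ Real.exp (lam i * (Vstar i + ι - f π' i) / μ) := by
    intro i
    have h4 := h3 i
    set A := lam i * (Vstar i + ι - f π i) / μ with hA
    have hA' : (Vstar i + ι - f π i) / μ * lam i = A := by rw [hA]; ring
    rw [hA'] at h4
    have hB : lam i * (Vstar i + ι - f π' i) / μ = A + lam i * (f π i - f π' i) / μ := by
      rw [hA]; ring
    rw [hB, Real.exp_add]
    have h5 := Real.add_one_le_exp (lam i * (f π i - f π' i) / μ)
    calc Real.exp A + c / μ * (w i * f π i - w i * f π' i)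
        = Real.exp A + (c * w i) * ((f π i - f π' i) / μ) := by ring
      _ = Real.exp A * (lam i * (f π i - f π' i) / μ + 1) := by rw [← h4]; ring
      _ ≤ _ := by gcongr
  have hsum := Finset.sum_le_sum fun i (_ : i ∈ Finset.univ) => hterm i
  rw [Finset.sum_add_distrib, ← Finset.mul_sum, Finset.sum_sub_distrib] at hsum
  have : 0 ≤ c / μ * (∑ i, w i * f π i - ∑ i, w i * f π' i) :=
    mul_nonneg (div_nonneg hc hμ.le) (sub_nonneg.mpr (hmax π'))
  linarith

theorem stch_lt {Pol : Type*} {m : ℕ} (hm : 1 ≤ m) (f : Pol → Fin m → ℝ)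
    (Vstar : Fin m → ℝ) (ι : ℝ) (μ : ℝ) (hμ : 0 < μ) (π π' : Pol) (lam : Fin m → ℝ)
    (hl : ∀ i, 0 ≤ lam i) (hle : ∀ i, f π i ≤ f π' i) (j : Fin m) (hj : f π j < f π' j)
    (hlj : 0 < lam j) : STCH Vstar ι μ f lam π' < STCH Vstar ι μ f lam π := by
  haveI : Nonempty (Fin m) := ⟨⟨0, hm⟩⟩
  refine mul_lt_mul_of_pos_left (Real.log_lt_log
    (Finset.sum_pos (fun i _ => Real.exp_pos _) Finset.univ_nonempty) ?_) hμ
  refine Finset.sum_lt_sum (fun i _ => ?_) ⟨j, Finset.mem_univ j, ?_⟩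
  · have := hl i
    have := hle i
    gcongr
  · gcongr


/-- If the image of the objective map is a convex polytope, then for every
smoothing parameter `μ > 0` the minimizers of the smooth Tchebycheff
scalarization over strictly positive preferences are exactly the Pareto optimal
policies, and the minimizers over arbitrary simplex preferences are exactly the
weakly Pareto optimal policies. -/
theorem stch_minimizers_of_polytope
    {Pol : Type*} [Nonempty Pol] {m : ℕ} (hm : 1 ≤ m) (f : Pol → Fin m → ℝ)
    (hpoly : ∃ F : Finset (Fin m → ℝ),
      Set.range f = convexHull ℝ (F : Set (Fin m → ℝ)))
    (Vstar : Fin m → ℝ)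
    (hV : ∀ i, IsGreatest (Set.range fun π : Pol => f π i) (Vstar i))
    (ι : ℝ) (hι : 0 < ι) :
    ∀ μ : ℝ, 0 < μ →
      ({π : Pol | ∃ lam ∈ stdSimplex ℝ (Fin m), (∀ i, 0 < lam i) ∧
          ∀ π' : Pol, STCH Vstar ι μ f lam π ≤ STCH Vstar ι μ f lam π'}
        = {π : Pol | ParetoOptimal f π}) ∧
      ({π : Pol | ∃ lam ∈ stdSimplex ℝ (Fin m),
          ∀ π' : Pol, STCH Vstar ι μ f lam π ≤ STCH Vstar ι μ f lam π'}
        = {π : Pol | WeaklyParetoOptimal f π}) := by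
  intro μ hμ
  obtain ⟨F, hF⟩ := hpoly
  have hVle : ∀ π i, f π i ≤ Vstar i := fun π i => (hV i).2 ⟨π, rfl⟩
  constructor
  · ext π
    constructor
    · rintro ⟨lam, hl, hpos, hmin⟩ ⟨π', hle, j, hj⟩
      exact absurd (hmin π')
        (not_le.mpr (stch_lt hm f Vstar ι μ hμ π π' lam hl.1 hle j hj (hpos j)))
    · intro hπ
      obtain ⟨w, hw, hmax⟩ := strict_weights F (f π) (by
        rw [← hF]
        rintro _ ⟨π', rfl⟩ hle
        by_contra hne
        refine hπ ⟨π', hle, ?_⟩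
        by_contra hcon
        push Not at hcon
        exact hne (funext fun i => le_antisymm (hcon i) (hle i)))
      rw [← hF] at hmax
      obtain ⟨lam, h1, h2, h3⟩ := exists_lam_min hm f Vstar ι hι μ hμ π (hVle π) w
        (fun i => (hw i).le) ⟨⟨0, hm⟩, hw _⟩ (fun π' => hmax _ ⟨π', rfl⟩)
      exact ⟨lam, h1, fun i => h2 i (hw i), h3⟩
  · ext π
    constructor
    · rintro ⟨lam, hl, hmin⟩ ⟨π', hlt⟩
      have hex : ∃ j, 0 < lam j := by
        by_contra hcon
        push Not at hcon
        have h1 := hl.2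
        have h2 : ∑ i, lam i ≤ 0 := Finset.sum_nonpos fun i _ => hcon i
        linarith
      obtain ⟨j, hj⟩ := hex
      exact absurd (hmin π')
        (not_le.mpr (stch_lt hm f Vstar ι μ hμ π π' lam hl.1 (fun i => (hlt i).le) j (hlt j) hj))
    · intro hπ
      obtain ⟨w, hw, hw1, hmax⟩ := weak_weights hm (Set.range f)
        (by rw [hF]; exact convex_convexHull ℝ _) (f π) ⟨π, rfl⟩ (by
          rintro _ ⟨π', rfl⟩ hlt
          exact hπ ⟨π', hlt⟩)
      obtain ⟨lam, h1, h2, h3⟩ := exists_lam_min hm f Vstar ι hι μ hμ π (hVle π) w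
        hw hw1 (fun π' => hmax _ ⟨π', rfl⟩)
      exact ⟨lam, h1, h3⟩
end

section
/- Suppose the image f(Π) ⊆ ℝ^m is a convex set, each f_i attains its maximum V_i^* over Π, and fix ι > 0, μ > 0 and λ ∈ Δ_m^o. If π̃ and π̄ both minimize STCH_λ^μ over Π (i.e., STCH_λ^μ(π̃) ≤ STCH_λ^μ(π') and STCH_λ^μ(π̄) ≤ STCH_λ^μ(π') for all π' ∈ Π), then f_i(π̃) = f_i(π̄) for all i ∈ {1,…,m}; i.e., all minimizers of the smooth Tchebycheff scalarization for a fixed strictly positive preference have the same objective-value vector. -/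
/-- If the image of the objective map is convex, then for a fixed strictly
positive preference vector all minimizers of the smooth Tchebycheff
scalarization have the same objective-value vector. -/
theorem stch_minimizers_same_values
    {Pol : Type*} [Nonempty Pol] {m : ℕ} (hm : 1 ≤ m) (f : Pol → Fin m → ℝ)
    (hconv : Convex ℝ (Set.range f))
    (Vstar : Fin m → ℝ)
    (hV : ∀ i, IsGreatest (Set.range fun π : Pol => f π i) (Vstar i))
    (ι : ℝ) (hι : 0 < ι) (μ : ℝ) (hμ : 0 < μ)
    (lam : Fin m → ℝ) (hlam : lam ∈ stdSimplex ℝ (Fin m)) (hlampos : ∀ i, 0 < lam i)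
    (πt πb : Pol)
    (hπt : ∀ π' : Pol, STCH Vstar ι μ f lam πt ≤ STCH Vstar ι μ f lam π')
    (hπb : ∀ π' : Pol, STCH Vstar ι μ f lam πb ≤ STCH Vstar ι μ f lam π') :
    ∀ i, f πt i = f πb i := by
  classical
  intro j
  by_contra hne
  have : Nonempty (Fin m) := ⟨j⟩
  have hpos : ∀ π : Pol, 0 < ∑ i, Real.exp (lam i * (Vstar i + ι - f π i) / μ) := fun π =>
    Finset.sum_pos (fun i _ => Real.exp_pos _) Finset.univ_nonempty
  have key : ∀ p q : Pol, STCH Vstar ι μ f lam p ≤ STCH Vstar ι μ f lam q →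
      ∑ i, Real.exp (lam i * (Vstar i + ι - f p i) / μ) ≤
        ∑ i, Real.exp (lam i * (Vstar i + ι - f q i) / μ) := by
    intro p q h
    unfold STCH at h
    exact (Real.log_le_log_iff (hpos p) (hpos q)).1 (le_of_mul_le_mul_left h hμ)
  obtain ⟨p, hp⟩ := hconv (Set.mem_range_self πt) (Set.mem_range_self πb)
    (by norm_num : (0 : ℝ) ≤ 1 / 2) (by norm_num : (0 : ℝ) ≤ 1 / 2) (by norm_num)
  have hp' : ∀ i, f p i = (f πt i + f πb i) / 2 := by
    intro i
    rw [hp]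
    simp only [Pi.add_apply, Pi.smul_apply, smul_eq_mul]
    ring
  have h1 := key _ _ (hπt p)
  have h2 := key _ _ (hπb p)
  have hmid : ∀ i, lam i * (Vstar i + ι - f p i) / μ =
      (1 / 2 : ℝ) • (lam i * (Vstar i + ι - f πt i) / μ) +
        (1 / 2 : ℝ) • (lam i * (Vstar i + ι - f πb i) / μ) := by
    intro i
    rw [hp' i]
    simp only [smul_eq_mul]
    ring
  have hlt : ∑ i, Real.exp (lam i * (Vstar i + ι - f p i) / μ) <
      ∑ i, ((1 / 2 : ℝ) * Real.exp (lam i * (Vstar i + ι - f πt i) / μ) +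
        (1 / 2 : ℝ) * Real.exp (lam i * (Vstar i + ι - f πb i) / μ)) := by
    refine Finset.sum_lt_sum (fun i _ => ?_) ⟨j, Finset.mem_univ j, ?_⟩
    · rw [hmid i]
      exact convexOn_exp.2 (Set.mem_univ _) (Set.mem_univ _) (by norm_num) (by norm_num)
        (by norm_num)
    · rw [hmid j]
      refine strictConvexOn_exp.2 (Set.mem_univ _) (Set.mem_univ _) ?_ (by norm_num)
        (by norm_num) (by norm_num)
      intro h
      apply hne
      have h3 := mul_left_cancel₀ (hlampos j).ne' ((div_left_inj' hμ.ne').1 h)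
      linarith
  rw [Finset.sum_add_distrib, ← Finset.mul_sum, ← Finset.mul_sum] at hlt
  linarith
end

section
/- Let m ≥ 2 and T ≥ 1 be integers, H ≥ 1 a real number, μ a real with 0 < μ ≤ 1, and g^1,…,g^T ∈ ℝ^m vectors with |g_i^t| ≤ 3H for all i and t. Set η := 1/(2H√T). Define w^1 ∈ Δ_m by w_i^1 := 1/m and, for t = 1,…,T−1, w_i^{t+1} := (w_i^t)^{1−μη} · exp(η g_i^t) / Σ_{j=1}^m (w_j^t)^{1−μη} · exp(η g_j^t). Then for every w ∈ Δ_m (with the convention 0·log 0 = 0), (1/T) Σ_{t=1}^T [ Σ_{i=1}^m (w_i − w_i^t) g_i^t − μ Σ_{i=1}^m w_i log w_i + μ Σ_{i=1}^m w_i^t log w_i^t ] ≤ (2H log m + 5H)/√T. -/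
open MeasureTheory ProbabilityTheory in
lemma hoeffding_fin {m : ℕ} (w y : Fin m → ℝ) (hw : ∀ i, 0 ≤ w i) (hs : ∑ i, w i = 1)
    (c : ℝ) (hc : 0 ≤ c) (hy : ∀ i, |y i| ≤ c) :
    ∑ i, w i * Real.exp (y i) ≤ Real.exp (∑ i, w i * y i + c ^ 2 / 2) := by
  let p : PMF (Fin m) := PMF.ofFintype (fun i => ENNReal.ofReal (w i)) (by
    rw [← ENNReal.ofReal_sum_of_nonneg (fun i _ => hw i), hs, ENNReal.ofReal_one])
  have hp : ∀ i, (p i).toReal = w i := fun i => by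
    simp [p, PMF.ofFintype_apply, ENNReal.toReal_ofReal (hw i)]
  have h := hasSubgaussianMGF_of_mem_Icc (X := y) (μ := p.toMeasure) (a := -c) (b := c)
    (Measurable.of_discrete).aemeasurable
    (Filter.Eventually.of_forall fun i => abs_le.mp (hy i))
  have h2 := h.mgf_le 1
  have hint : p.toMeasure[y] = ∑ i, w i * y i := by
    rw [PMF.integral_eq_sum]; simp [hp]
  rw [hint] at h2
  rw [mgf, PMF.integral_eq_sum] at h2
  simp only [hp, smul_eq_mul, one_mul, Real.exp_sub] at h2
  have e : ∑ i, w i * (Real.exp (y i) / Real.exp (∑ i, w i * y i))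
      = (∑ i, w i * Real.exp (y i)) / Real.exp (∑ i, w i * y i) := by
    rw [Finset.sum_div]; exact Finset.sum_congr rfl fun i _ => by ring
  rw [e, div_le_iff₀ (Real.exp_pos _), ← Real.exp_add] at h2
  refine h2.trans (Real.exp_le_exp.mpr (le_of_eq ?_))
  have : |c + c| = 2 * c := by rw [abs_of_nonneg (by linarith)]; ring
  simp [this]
  ring

lemma gibbs_fin {m : ℕ} (p q : Fin m → ℝ) (hp : ∀ i, 0 ≤ p i) (hs : ∑ i, p i = 1)
    (hq : ∀ i, 0 < q i) :
    ∑ i, p i * (Real.log (q i) - Real.log (p i)) ≤ Real.log (∑ i, q i) := by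
  have hne : (Finset.univ : Finset (Fin m)).Nonempty := by
    by_contra h
    rw [Finset.not_nonempty_iff_eq_empty] at h
    rw [h] at hs; simp at hs
  have hS : 0 < ∑ i, q i := Finset.sum_pos (fun i _ => hq i) hne
  set S := ∑ i, q i with hSdef
  have key : ∀ i, p i * (Real.log (q i) - Real.log (p i))
      ≤ p i * Real.log S + (q i / S - p i) := by
    intro i
    rcases (hp i).eq_or_lt with h | h
    · rw [← h]; simp; exact (div_pos (hq i) hS).le
    · have h1 := Real.log_le_sub_one_of_pos (div_pos (hq i) (mul_pos hS h))
      rw [Real.log_div (hq i).ne' (mul_pos hS h).ne', Real.log_mul hS.ne' h.ne'] at h1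
      have h2 := mul_le_mul_of_nonneg_left h1 h.le
      have h3 : p i * (q i / (S * p i) - 1) = q i / S - p i := by
        field_simp
      rw [h3] at h2
      linarith
  calc _ ≤ ∑ i, (p i * Real.log S + (q i / S - p i)) := Finset.sum_le_sum fun i _ => key i
    _ = Real.log S := by
      rw [Finset.sum_add_distrib, Finset.sum_sub_distrib, ← Finset.sum_mul, ← Finset.sum_div, hs,
        ← hSdef, div_self hS.ne']
      ring

/-- one mirror ascent step -/
noncomputable def maStep {m : ℕ} (a η : ℝ) (w g : Fin m → ℝ) : Fin m → ℝ := fun i =>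
  w i ^ a * Real.exp (η * g i) / ∑ j, w j ^ a * Real.exp (η * g j)

lemma maStep_spec {m : ℕ} [NeZero m] (a η : ℝ) (w g : Fin m → ℝ) (hw : ∀ i, 0 < w i) :
    (∀ i, 0 < maStep a η w g i) ∧ ∑ i, maStep a η w g i = 1 ∧
    ∀ i, Real.log (maStep a η w g i) = a * Real.log (w i) + η * g i
      - Real.log (∑ j, w j ^ a * Real.exp (η * g j)) := by
  have hq : ∀ i, 0 < w i ^ a * Real.exp (η * g i) := fun i =>
    mul_pos (Real.rpow_pos_of_pos (hw i) _) (Real.exp_pos _)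
  have hS : 0 < ∑ j, w j ^ a * Real.exp (η * g j) :=
    Finset.sum_pos (fun i _ => hq i) Finset.univ_nonempty
  refine ⟨fun i => div_pos (hq i) hS, ?_, fun i => ?_⟩
  · simp only [maStep]
    rw [← Finset.sum_div, div_self hS.ne']
  · rw [maStep, Real.log_div (hq i).ne' hS.ne',
      Real.log_mul (Real.rpow_pos_of_pos (hw i) _).ne' (Real.exp_pos _).ne',
      Real.log_rpow (hw i), Real.log_exp]

lemma step_ineq {m : ℕ} [NeZero m] (a η μ B : ℝ) (w g wb : Fin m → ℝ) (hw : ∀ i, 0 < w i)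
    (hs : ∑ i, w i = 1) (ha : a = 1 - μ * η) (ha2 : 1 / 2 ≤ a) (ha1 : a ≤ 1) (hη : 0 ≤ η)
    (hB : 0 ≤ B) (hg : ∀ i, |g i| ≤ B) (hb : ∀ i, 0 ≤ wb i) (hbs : ∑ i, wb i = 1) :
    η * (∑ i, (wb i - w i) * g i - μ * ∑ i, wb i * Real.log (wb i)
      + μ * ∑ i, w i * Real.log (w i))
    ≤ η ^ 2 * B ^ 2 + ∑ i, wb i * (Real.log (wb i) - Real.log (w i))
      - ∑ i, wb i * (Real.log (wb i) - Real.log (maStep a η w g i))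
      - μ * η * ∑ i, maStep a η w g i * Real.log (maStep a η w g i)
      + μ * η * ∑ i, w i * Real.log (w i) := by
  obtain ⟨hp', hs', hl'⟩ := maStep_spec a η w g hw
  set w' := maStep a η w g
  set L := Real.log (∑ j, w j ^ a * Real.exp (η * g j))
  have ha0 : 0 < a := by linarith
  have e1 : ∑ i, wb i * (Real.log (wb i) - Real.log (w' i))
      = ∑ i, wb i * Real.log (wb i) - a * ∑ i, wb i * Real.log (w i) - η * ∑ i, wb i * g i + L := by
    calc _ = ∑ i, (wb i * Real.log (wb i) - a * (wb i * Real.log (w i)) - η * (wb i * g i)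
          + wb i * L) := Finset.sum_congr rfl fun i _ => by rw [hl']; ring
      _ = _ := by
        rw [Finset.sum_add_distrib, Finset.sum_sub_distrib, Finset.sum_sub_distrib,
          ← Finset.mul_sum, ← Finset.mul_sum, ← Finset.sum_mul, hbs, one_mul]
  have e2 : ∑ i, wb i * (Real.log (wb i) - Real.log (w i))
      = ∑ i, wb i * Real.log (wb i) - ∑ i, wb i * Real.log (w i) := by
    simp only [mul_sub, Finset.sum_sub_distrib]
  have e3 : ∑ i, w' i * Real.log (w' i)
      = a * ∑ i, w' i * Real.log (w i) + η * ∑ i, w' i * g i - L := by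
    calc _ = ∑ i, (a * (w' i * Real.log (w i)) + η * (w' i * g i)
          - w' i * L) := Finset.sum_congr rfl fun i _ => by rw [hl']; ring
      _ = _ := by
        rw [Finset.sum_sub_distrib, Finset.sum_add_distrib,
          ← Finset.mul_sum, ← Finset.mul_sum, ← Finset.sum_mul, hs', one_mul]
  have e4 : ∑ i, (wb i - w i) * g i = ∑ i, wb i * g i - ∑ i, w i * g i := by
    simp only [sub_mul, Finset.sum_sub_distrib]
  have k0 := gibbs_fin wb w hb hbs hw
  rw [hs, Real.log_one] at k0
  have k0' : ∑ i, wb i * (Real.log (w i) - Real.log (wb i))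
      = ∑ i, wb i * Real.log (w i) - ∑ i, wb i * Real.log (wb i) := by
    simp only [mul_sub, Finset.sum_sub_distrib]
  rw [k0'] at k0
  have k1 := gibbs_fin w' (fun i => w i * Real.exp (η * g i / a)) (fun i => (hp' i).le) hs'
    (fun i => mul_pos (hw i) (Real.exp_pos _))
  have k1' : ∑ i, w' i * (Real.log (w i * Real.exp (η * g i / a)) - Real.log (w' i))
      = ∑ i, w' i * Real.log (w i) + η / a * ∑ i, w' i * g i - ∑ i, w' i * Real.log (w' i) := by
    calc _ = ∑ i, (w' i * Real.log (w i) + η / a * (w' i * g i) - w' i * Real.log (w' i)) :=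
          Finset.sum_congr rfl fun i _ => by
            rw [Real.log_mul (hw i).ne' (Real.exp_pos _).ne', Real.log_exp]; ring
      _ = _ := by
        rw [Finset.sum_sub_distrib, Finset.sum_add_distrib, ← Finset.mul_sum]
  have k2 := hoeffding_fin w (fun i => η * g i / a) (fun i => (hw i).le) hs (η * B / a)
    (by positivity) (fun i => by
      rw [abs_div, abs_mul, abs_of_nonneg hη, abs_of_pos ha0]
      have := hg i
      gcongr)
  have k3 : ∑ i, w i * (η * g i / a) = η / a * ∑ i, w i * g i := by
    rw [Finset.mul_sum]; exact Finset.sum_congr rfl fun i _ => by ring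
  rw [k3] at k2
  have k4 := Real.log_le_log (Finset.sum_pos (fun i _ => mul_pos (hw i) (Real.exp_pos _))
    Finset.univ_nonempty) k2
  rw [Real.log_exp] at k4
  rw [k1'] at k1
  have k5 := mul_le_mul_of_nonneg_left (k1.trans k4) ha0.le
  have k6 : a * (η / a * ∑ i, w i * g i + (η * B / a) ^ 2 / 2)
      = η * ∑ i, w i * g i + η ^ 2 * B ^ 2 / (2 * a) := by field_simp
  have k7 : a * (∑ i, w' i * Real.log (w i) + η / a * ∑ i, w' i * g i
        - ∑ i, w' i * Real.log (w' i))
      = a * ∑ i, w' i * Real.log (w i) + η * ∑ i, w' i * g i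
        - a * ∑ i, w' i * Real.log (w' i) := by field_simp
  rw [k6, k7] at k5
  have k8 : η ^ 2 * B ^ 2 / (2 * a) ≤ η ^ 2 * B ^ 2 :=
    div_le_self (by positivity) (by linarith)
  have hμη : μ * η = 1 - a := by linarith
  have k9 := mul_nonpos_of_nonneg_of_nonpos (show 0 ≤ μ * η by linarith) k0
  rw [e1, e2, e4]
  generalize ∑ i, w' i * Real.log (w' i) = A1 at *
  generalize ∑ i, w' i * Real.log (w i) = A2 at *
  generalize ∑ i, w' i * g i = A3 at *
  generalize ∑ i, w i * g i = A4 at *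
  generalize ∑ i, wb i * Real.log (w i) = A5 at *
  generalize ∑ i, wb i * Real.log (wb i) = A6 at *
  generalize ∑ i, wb i * g i = A7 at *
  generalize ∑ i, w i * Real.log (w i) = A8 at *
  generalize η ^ 2 * B ^ 2 = A9 at *
  subst ha
  linarith

/-- the iterates, shifted by one -/
noncomputable def maIter {m : ℕ} (a η : ℝ) (g : ℕ → Fin m → ℝ) : ℕ → Fin m → ℝ
  | 0 => fun _ => 1 / m
  | k + 1 => maStep a η (maIter a η g k) (g (k + 1))

lemma maIter_spec {m : ℕ} [NeZero m] (a η : ℝ) (g : ℕ → Fin m → ℝ) (k : ℕ) :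
    (∀ i, 0 < maIter a η g k i) ∧ ∑ i, maIter a η g k i = 1 := by
  have hm : (0 : ℝ) < m := by exact_mod_cast Nat.pos_of_ne_zero (NeZero.ne m)
  induction k with
  | zero =>
    refine ⟨fun i => by simp only [maIter]; positivity, ?_⟩
    simp [maIter, hm.ne']
  | succ k ih =>
    have := maStep_spec a η (maIter a η g k) (g (k + 1)) ih.1
    exact ⟨this.1, this.2.1⟩

lemma sum_ineq {m : ℕ} [NeZero m] (T : ℕ) (a η μ B : ℝ) (g : ℕ → Fin m → ℝ) (wb : Fin m → ℝ)
    (ha : a = 1 - μ * η) (ha2 : 1 / 2 ≤ a) (ha1 : a ≤ 1) (hη : 0 ≤ η)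
    (hB : 0 ≤ B) (hg : ∀ t, 1 ≤ t → t ≤ T → ∀ i, |g t i| ≤ B)
    (hb : ∀ i, 0 ≤ wb i) (hbs : ∑ i, wb i = 1) (n : ℕ) (hn : n ≤ T) :
    ∑ k ∈ Finset.range n,
      η * (∑ i, (wb i - maIter a η g k i) * g (k + 1) i - μ * ∑ i, wb i * Real.log (wb i)
      + μ * ∑ i, maIter a η g k i * Real.log (maIter a η g k i))
    ≤ n * (η ^ 2 * B ^ 2) + ∑ i, wb i * (Real.log (wb i) - Real.log (maIter a η g 0 i))
      - ∑ i, wb i * (Real.log (wb i) - Real.log (maIter a η g n i))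
      - μ * η * ∑ i, maIter a η g n i * Real.log (maIter a η g n i)
      + μ * η * ∑ i, maIter a η g 0 i * Real.log (maIter a η g 0 i) := by
  induction n with
  | zero => simp
  | succ n ih =>
    have h1 := ih (by omega)
    have h2 := step_ineq a η μ B (maIter a η g n) (g (n + 1)) wb (maIter_spec a η g n).1
      (maIter_spec a η g n).2 ha ha2 ha1 hη hB (hg (n + 1) (by omega) hn) hb hbs
    rw [Finset.sum_range_succ]
    push_cast
    change _ ≤ _ + _ - ∑ i, wb i * (Real.log (wb i)
      - Real.log (maStep a η (maIter a η g n) (g (n + 1)) i))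
      - μ * η * ∑ i, maStep a η (maIter a η g n) (g (n + 1)) i
        * Real.log (maStep a η (maIter a η g n) (g (n + 1)) i) + _
    linarith

/-- Regret bound for entropy-regularized mirror ascent on the probability
simplex: with step size `η = 1/(2H√T)`, regularization strength `0 < μ ≤ 1`,
uniform initialization and rewards bounded by `3H` (with `H ≥ 1`), the average
entropy-regularized regret against any fixed `w ∈ Δ_m` is at most
`(2H log m + 5H)/√T`.  (Here `Real.log 0 = 0` realizes the convention
`0 · log 0 = 0`.) -/
theorem regularized_mirror_ascent_regret
    {m T : ℕ} (hm : 2 ≤ m) (hT : 1 ≤ T) (H : ℝ) (hH : 1 ≤ H)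
    (μ : ℝ) (hμ0 : 0 < μ) (hμ1 : μ ≤ 1)
    (g : ℕ → Fin m → ℝ) (hg : ∀ t, 1 ≤ t → t ≤ T → ∀ i, |g t i| ≤ 3 * H)
    (η : ℝ) (hη : η = 1 / (2 * H * Real.sqrt T))
    (w : ℕ → Fin m → ℝ) (hw1 : ∀ i, w 1 i = 1 / m)
    (hrec : ∀ t, 1 ≤ t → t < T → ∀ i,
      w (t + 1) i = w t i ^ (1 - μ * η) * Real.exp (η * g t i) /
        ∑ j, w t j ^ (1 - μ * η) * Real.exp (η * g t j)) :
    ∀ wbar ∈ stdSimplex ℝ (Fin m),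
      (1 / (T : ℝ)) * ∑ t ∈ Finset.Icc 1 T,
          (∑ i, (wbar i - w t i) * g t i
            - μ * ∑ i, wbar i * Real.log (wbar i)
            + μ * ∑ i, w t i * Real.log (w t i))
        ≤ (2 * H * Real.log m + 5 * H) / Real.sqrt T := by
  intro wb hwb
  obtain ⟨hb, hbs⟩ := hwb
  have : NeZero m := ⟨by omega⟩
  have hTr : (1 : ℝ) ≤ T := by exact_mod_cast hT
  have hm0 : (0 : ℝ) < m := by exact_mod_cast (by omega : 0 < m)
  have hsq1 : 1 ≤ Real.sqrt T := Real.one_le_sqrt.mpr hTr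
  have hsq : Real.sqrt T * Real.sqrt T = T := Real.mul_self_sqrt (by linarith)
  set s := Real.sqrt T with hs
  have hden : 2 ≤ 2 * H * s := by nlinarith
  have hη0 : 0 < η := by rw [hη]; positivity
  have hη2 : η ≤ 1 / 2 := by
    rw [hη]; exact one_div_le_one_div_of_le (by norm_num) hden
  have hμη : μ * η ≤ 1 / 2 := by nlinarith
  have hμη0 : 0 < μ * η := by positivity
  have hwit : ∀ k, k < T → w (k + 1) = maIter (1 - μ * η) η g k := by
    intro k
    induction k with
    | zero => intro _; funext i; simp [maIter, hw1]
    | succ k ih =>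
      intro hk
      funext i
      rw [hrec (k + 1) (by omega) hk i, ih (by omega)]
      rfl
  have main := sum_ineq T (1 - μ * η) η μ (3 * H) g wb rfl (by linarith) (by linarith) hη0.le
    (by linarith) hg hb hbs T le_rfl
  obtain ⟨hp, hps⟩ := maIter_spec (1 - μ * η) η g T
  set u := maIter (1 - μ * η) η g with hu
  have hu0 : ∀ i, Real.log (u 0 i) = - Real.log m := fun i => by
    simp [hu, maIter]
  have c1 : ∑ i, u 0 i * Real.log (u 0 i) = - Real.log m := by
    simp only [hu0]
    rw [← Finset.sum_mul, (maIter_spec (1 - μ * η) η g 0).2, one_mul]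
  have c2 : ∑ i, wb i * (Real.log (wb i) - Real.log (u 0 i)) ≤ Real.log m := by
    simp only [hu0, sub_neg_eq_add, mul_add]
    rw [Finset.sum_add_distrib, ← Finset.sum_mul, hbs, one_mul]
    have : ∑ i, wb i * Real.log (wb i) ≤ 0 := Finset.sum_nonpos fun i _ =>
      Real.mul_log_nonpos (hb i) (by
        rw [← hbs]; exact Finset.single_le_sum (fun j _ => hb j) (Finset.mem_univ i))
    linarith
  have c3 : 0 ≤ ∑ i, wb i * (Real.log (wb i) - Real.log (u T i)) := by
    have h := gibbs_fin wb (u T) hb hbs hp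
    rw [hps, Real.log_one] at h
    have : ∑ i, wb i * (Real.log (wb i) - Real.log (u T i))
        = - ∑ i, wb i * (Real.log (u T i) - Real.log (wb i)) := by
      rw [← Finset.sum_neg_distrib]; exact Finset.sum_congr rfl fun i _ => by ring
    linarith
  have c4 : - ∑ i, u T i * Real.log (u T i) ≤ Real.log m := by
    have h := gibbs_fin (u T) (fun _ => 1) (fun i => (hp i).le) hps (fun _ => one_pos)
    simpa using h
  have c5 := mul_le_mul_of_nonneg_left c4 hμη0.le
  have c6 : (T : ℝ) * (η ^ 2 * (3 * H) ^ 2) = 9 / 4 := by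
    rw [hη, ← hsq]
    have : s ≠ 0 := by positivity
    have : H ≠ 0 := by positivity
    field_simp
    norm_num
  rw [c1, c6, ← Finset.mul_sum] at main
  have hsum : ∑ t ∈ Finset.Icc 1 T,
          (∑ i, (wb i - w t i) * g t i
            - μ * ∑ i, wb i * Real.log (wb i)
            + μ * ∑ i, w t i * Real.log (w t i))
      = ∑ k ∈ Finset.range T, (∑ i, (wb i - u k i) * g (k + 1) i
        - μ * ∑ i, wb i * Real.log (wb i) + μ * ∑ i, u k i * Real.log (u k i)) := by
    rw [← Finset.Ico_add_one_right_eq_Icc, Finset.sum_Ico_eq_sum_range]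
    refine Finset.sum_congr (by simp) fun k hk => ?_
    rw [add_comm 1 k, hwit k (by simpa using hk)]
  rw [hsum]
  set F := ∑ k ∈ Finset.range T, (∑ i, (wb i - u k i) * g (k + 1) i
        - μ * ∑ i, wb i * Real.log (wb i) + μ * ∑ i, u k i * Real.log (u k i))
  have hF : η * F ≤ Real.log m + 5 / 2 := by linarith
  have hF2 : F ≤ (2 * H * s) * (Real.log m + 5 / 2) := by
    rw [hη, one_div, inv_mul_le_iff₀ (by positivity)] at hF
    exact hF
  rw [← hsq, le_div_iff₀ (by positivity)]
  have : 1 / (s * s) * F * s = F / s := by field_simp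
  rw [this, div_le_iff₀ (by positivity)]
  linarith
end

section
/- Let X be a finite nonempty set, T ≥ 1 an integer, and x_1, …, x_T ∈ X a sequence. For 1 ≤ t ≤ T and x ∈ X let N^{t−1}(x) := #{ τ ∈ {1,…,t−1} : x_τ = x } denote the number of occurrences of x strictly before time t. Then Σ_{t=1}^T ( max(N^{t−1}(x_t), 1) )^{−1/2} ≤ 3 √( |X| · T ). -/
theorem visit_step (n : ℕ) :
    (Real.sqrt ((max n 1 : ℕ) : ℝ))⁻¹ ≤ 3 * Real.sqrt ((n + 1 : ℕ) : ℝ) - 3 * Real.sqrt (n : ℝ) := by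
  rcases Nat.eq_zero_or_pos n with rfl | hn
  · norm_num
  · rw [max_eq_left hn]
    have hn' : (1 : ℝ) ≤ n := by exact_mod_cast hn
    have ha : 0 < Real.sqrt (n : ℝ) := Real.sqrt_pos.mpr (by linarith)
    have ha2 := Real.sq_sqrt (show (0 : ℝ) ≤ n by linarith)
    have hb2 := Real.sq_sqrt (show (0 : ℝ) ≤ ((n + 1 : ℕ) : ℝ) by positivity)
    have hb : 0 ≤ Real.sqrt ((n + 1 : ℕ) : ℝ) := Real.sqrt_nonneg _
    push_cast at *
    generalize Real.sqrt (n : ℝ) = a at *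
    generalize Real.sqrt ((n : ℝ) + 1) = b at *
    have h1 : b ≤ 2 * a := by nlinarith
    have h2 : (b - a) * (b + a) = 1 := by nlinarith
    have h3 : 0 ≤ b - a := by nlinarith
    rw [inv_le_iff_one_le_mul₀ ha]
    nlinarith

theorem visit_sum {X : Type*} [Fintype X] [DecidableEq X] (x : ℕ → X) (T : ℕ) :
    ∑ t ∈ Finset.Icc 1 T,
        (Real.sqrt ((max ((Finset.Icc 1 (t - 1)).filter fun τ => x τ = x t).card 1 : ℕ) : ℝ))⁻¹
      ≤ ∑ y : X, 3 * Real.sqrt (((Finset.Icc 1 T).filter fun τ => x τ = y).card : ℝ) := by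
  induction T with
  | zero => simp
  | succ T ih =>
    rw [Finset.sum_Icc_succ_top (by omega)]
    have hs := visit_step ((Finset.Icc 1 T).filter fun τ => x τ = x (T + 1)).card
    have hI : Finset.Icc 1 (T + 1) = insert (T + 1) (Finset.Icc 1 T) := by
      ext; simp; omega
    have hc : ∀ y, ((Finset.Icc 1 (T + 1)).filter fun τ => x τ = y).card
        = ((Finset.Icc 1 T).filter fun τ => x τ = y).card + if x (T + 1) = y then 1 else 0 := by
      intro y
      rw [hI, Finset.filter_insert]
      split_ifs with h
      · rw [Finset.card_insert_of_notMem (by simp)]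
      · simp
    simp only [hc, Nat.add_sub_cancel]
    rw [← Finset.add_sum_erase _ _ (Finset.mem_univ (x (T + 1)))] at ih ⊢
    have he : ∑ y ∈ Finset.univ.erase (x (T + 1)), 3 * Real.sqrt
          ((((Finset.Icc 1 T).filter fun τ => x τ = y).card + if x (T + 1) = y then 1 else 0 : ℕ) : ℝ)
        = ∑ y ∈ Finset.univ.erase (x (T + 1)), 3 * Real.sqrt
          (((Finset.Icc 1 T).filter fun τ => x τ = y).card : ℝ) := by
      refine Finset.sum_congr rfl fun y hy => ?_
      rw [if_neg (Finset.ne_of_mem_erase hy).symm, Nat.add_zero]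
    rw [he, if_pos rfl]
    linarith

/-- Pigeonhole bound for inverse-square-root visit counts: along any sequence
`x_1, …, x_T` in a finite set `X`, the sum over time of
`1 / √(max(N^{t−1}(x_t), 1))`, where `N^{t−1}(x_t)` is the number of previous
occurrences of the current element, is at most `3 √(|X| T)`. -/
theorem sum_inv_sqrt_visit_counts_le
    {X : Type*} [Fintype X] [Nonempty X] [DecidableEq X]
    (T : ℕ) (hT : 1 ≤ T) (x : ℕ → X) :
    ∑ t ∈ Finset.Icc 1 T,
        (Real.sqrt ((max ((Finset.Icc 1 (t - 1)).filter fun τ => x τ = x t).card 1 : ℕ) : ℝ))⁻¹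
      ≤ 3 * Real.sqrt ((Fintype.card X : ℝ) * T) := by
  refine (visit_sum x T).trans ?_
  rw [← Finset.mul_sum]
  refine mul_le_mul_of_nonneg_left ?_ (by norm_num)
  apply Real.le_sqrt_of_sq_le
  refine sq_sum_le_card_mul_sum_sq.trans (le_of_eq ?_)
  have hsum : ∑ y : X, ((Finset.Icc 1 T).filter fun τ => x τ = y).card = T := by
    rw [← Finset.card_eq_sum_card_fiberwise (fun _ _ => by simp)]
    simp
  simp only [Real.sq_sqrt (Nat.cast_nonneg _)]
  rw [← Nat.cast_sum, hsum, Finset.card_univ]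
end
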